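/- Let J = (q1, q2, c) be an ideal of R generated by two quadrics q1, q2 and a cubic c. Then pd(R/J) ≤ 4. -/

import Mathlib

open MvPolynomial Filter CategoryTheory

noncomputable section

/-- The height of an ideal `J`: the infimum of the heights of the prime ideals containing it. -/
def idealHeight {R : Type} [CommRing R] (J : Ideal R) : ℕ∞ :=
  ⨅ p ∈ {p : {q : Ideal R // q.IsPrime} | J ≤ p.1}, Order.height p

/-- `pdQuotLE J n` holds iff `R ⧸ J` admits a projective resolution of length at most `n`,
i.e. the projective dimension of `R ⧸ J` as an `R`-module is at most `n`. -/
def pdQuotLE {R : Type} [CommRing R] (J : Ideal R) (n : ℕ) : Prop :=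
  ∃ P : ProjectiveResolution (ModuleCat.of R (R ⧸ J)),
    ∀ i, n < i → Limits.IsZero (P.complex.X i)

/-- The `p`-primary component of `J` for `p` a minimal prime of `J`:
the saturation of `J` at `p`. -/
def primaryComponent {R : Type} [CommRing R] (J p : Ideal R) : Ideal R :=
  ⨆ (s : R) (_ : s ∉ p), Submodule.colon J (Ideal.span {s})

/-- The unmixed part `J^un` of `J`: the intersection of the primary components of `J`
corresponding to the minimal primes of `J` of minimal height. -/
def unmixedPart {R : Type} [CommRing R] (J : Ideal R) : Ideal R :=
  ⨅ p ∈ {p : Ideal R | p.IsPrime ∧ J ≤ p ∧ idealHeight p = idealHeight J},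
    primaryComponent J p

/-- A linear prime: a prime ideal generated by forms of degree one. -/
def IsLinearPrime {k : Type} [CommSemiring k] {N : ℕ} (p : Ideal (MvPolynomial (Fin N) k)) : Prop :=
  p.IsPrime ∧ ∃ S : Set (MvPolynomial (Fin N) k), (∀ ℓ ∈ S, ℓ.IsHomogeneous 1) ∧ p = Ideal.span S

/-- A homogeneous ideal: an ideal generated by homogeneous elements. -/
def IsHomogeneousIdeal {k : Type} [CommSemiring k] {N : ℕ}
    (J : Ideal (MvPolynomial (Fin N) k)) : Prop :=
  ∃ S : Set (MvPolynomial (Fin N) k), (∀ g ∈ S, ∃ d, g.IsHomogeneous d) ∧ J = Ideal.span S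

/-- `[B]_n`: the ideal generated by all forms of degree `n` belonging to `B`. -/
def degreePart {k : Type} [CommSemiring k] {N : ℕ} (B : Ideal (MvPolynomial (Fin N) k)) (n : ℕ) :
    Ideal (MvPolynomial (Fin N) k) :=
  Ideal.span {f | f ∈ B ∧ f.IsHomogeneous n}

/-- The Hilbert–Samuel function of `R/J` with respect to the irrelevant maximal ideal:
`n ↦ length (R / (J + 𝔪^n)) = dim_k (R / (J + 𝔪^n))`. -/
def hilbertSamuelFn {k : Type} [Field k] {N : ℕ} (J : Ideal (MvPolynomial (Fin N) k))
    (n : ℕ) : ℕ :=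
  Module.finrank k
    (MvPolynomial (Fin N) k ⧸
      (J ⊔ (Ideal.span (Set.range (MvPolynomial.X : Fin N → MvPolynomial (Fin N) k))) ^ n))

/-- `HasMultiplicity J d e`: the quotient `R/J` has Krull dimension `d` and Hilbert–Samuel
multiplicity `e`, expressed through the asymptotics `d! · HS_J(n) / n^d → e` of the
Hilbert–Samuel function. -/
def HasMultiplicity {k : Type} [Field k] {N : ℕ} (J : Ideal (MvPolynomial (Fin N) k))
    (d e : ℕ) : Prop :=
  Tendsto (fun n : ℕ => (Nat.factorial d : ℝ) * (hilbertSamuelFn J n : ℝ) / (n : ℝ) ^ d)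
    atTop (nhds (e : ℝ))

/-- An ideal of `R` is extended from a subalgebra `A` if it is generated by elements of `A`. -/
def extendedFrom {k R : Type} [CommRing k] [CommRing R] [Algebra k R]
    (K : Ideal R) (A : Subalgebra k R) : Prop :=
  ∃ S : Set R, S ⊆ (A : Set R) ∧ K = Ideal.span S


lemma exists_res_splice {C : Type*} [Category C] [Abelian C] (S : ShortComplex C)
    (hS : S.ShortExact) (h2 : Projective S.X₂) (Q : ChainComplex C ℕ)
    (hQ : ∀ n, Projective (Q.X n)) (ε : Q.X 0 ⟶ S.X₁) (hε : Epi ε) (w0 : Q.d 1 0 ≫ ε = 0)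
    (h0 : (ShortComplex.mk (Q.d 1 0) ε w0).Exact)
    (h1 : ∀ n, (ShortComplex.mk _ _ (Q.d_comp_d (n + 2) (n + 1) n)).Exact) :
    ∃ P : ProjectiveResolution S.X₃, ∀ i, P.complex.X (i + 1) = Q.X i := by
  have hmono := hS.mono_f
  have hepi := hS.epi_g
  have w : Q.d 1 0 ≫ ε ≫ S.f = 0 := by
    rw [← Category.assoc, w0, Limits.zero_comp]
  have w' : (ε ≫ S.f) ≫ S.g = 0 := by
    rw [Category.assoc, S.zero, Limits.comp_zero]
  let K := ChainComplex.augment Q (ε ≫ S.f) w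
  have e0 : (ShortComplex.mk (ε ≫ S.f) S.g w').Exact := by
    let α : ShortComplex.mk (ε ≫ S.f) S.g w' ⟶ ShortComplex.mk S.f S.g S.zero :=
      { τ₁ := ε
        τ₂ := 𝟙 _
        τ₃ := 𝟙 _ }
    have : Epi α.τ₁ := hε
    have : IsIso α.τ₂ := inferInstanceAs (IsIso (𝟙 _))
    have : Mono α.τ₃ := inferInstanceAs (Mono (𝟙 _))
    rw [ShortComplex.exact_iff_of_epi_of_isIso_of_mono α]
    exact hS.exact
  have e1 : (ShortComplex.mk (Q.d 1 0) (ε ≫ S.f) w).Exact := by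
    let α : ShortComplex.mk (Q.d 1 0) ε w0 ⟶ ShortComplex.mk (Q.d 1 0) (ε ≫ S.f) w :=
      { τ₁ := 𝟙 _
        τ₂ := 𝟙 _
        τ₃ := S.f }
    have : Epi α.τ₁ := inferInstanceAs (Epi (𝟙 _))
    have : IsIso α.τ₂ := inferInstanceAs (IsIso (𝟙 _))
    have : Mono α.τ₃ := inferInstanceAs (Mono S.f)
    rwa [← ShortComplex.exact_iff_of_epi_of_isIso_of_mono α]
  have ex : ∀ n, K.ExactAt (n + 1) := by
    intro n
    rw [HomologicalComplex.exactAt_iff' _ (n + 1 + 1) (n + 1) n (by simp) (by simp)]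
    match n with
    | 0 => exact e1
    | n + 1 => exact h1 n
  refine ⟨{ complex := K
            projective := ?_
            π := (ChainComplex.toSingle₀Equiv _ _).symm ⟨S.g, w'⟩
            quasiIso := ⟨fun n => ?_⟩ }, fun _ => rfl⟩
  · intro n
    match n with
    | 0 => exact h2
    | n + 1 => exact hQ n
  · cases n
    · rw [ChainComplex.quasiIsoAt₀_iff, ShortComplex.quasiIso_iff_of_zeros']
      · refine (ShortComplex.exact_and_epi_g_iff_of_iso ?_).2 ⟨e0, hepi⟩
        refine ShortComplex.isoMk (Iso.refl _) (Iso.refl _) (Iso.refl _) ?_ ?_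
        · exact (Category.id_comp _).trans (Category.comp_id _).symm
        · refine (Category.id_comp _).trans (Eq.trans ?_ (Category.comp_id _).symm)
          exact (ChainComplex.toSingle₀Equiv_symm_apply_f_zero (C := K) S.g w').symm
      all_goals rfl
    · rw [quasiIsoAt_iff_exactAt']
      · apply ex
      · apply ChainComplex.exactAt_succ_single_obj

lemma exists_res {C : Type*} [Category C] [Abelian C] [EnoughProjectives C] (n : ℕ) :
    ∀ (X : C), HasProjectiveDimensionLE X n →
    ∃ P : ProjectiveResolution X, ∀ i, n < i → Limits.IsZero (P.complex.X i) := by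
  induction n with
  | zero =>
    intro X h
    have : Projective X := (projective_iff_hasProjectiveDimensionLE_zero X).2 h
    refine ⟨ProjectiveResolution.self X, fun i hi => ?_⟩
    apply HomologicalComplex.isZero_single_obj_X
    show i ≠ 0
    omega
  | succ n ih =>
    intro X h
    let S : ShortComplex C := ShortComplex.mk (Limits.kernel.ι (Projective.π X)) (Projective.π X)
      (by simp)
    have hS : S.ShortExact :=
      { exact := ShortComplex.exact_of_f_is_kernel _ (Limits.kernelIsKernel _)
        mono_f := inferInstanceAs (Mono (Limits.kernel.ι (Projective.π X)))
        epi_g := inferInstanceAs (Epi (Projective.π X)) }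
    have hp : Projective S.X₂ := inferInstanceAs (Projective (Projective.over X))
    obtain ⟨Q, hQ⟩ := ih S.X₁ ((hS.hasProjectiveDimensionLT_X₃_iff n hp).1 h)
    obtain ⟨P, hP⟩ := exists_res_splice S hS hp Q.complex Q.projective (Q.π.f 0)
      (inferInstanceAs (Epi (Q.π.f 0))) Q.complex_d_comp_π_f_zero
      (ShortComplex.exact_of_g_is_cokernel _ Q.isColimitCokernelCofork) Q.exact_succ
    refine ⟨P, fun i hi => ?_⟩
    obtain ⟨j, rfl⟩ : ∃ j, i = j + 1 := ⟨i - 1, by omega⟩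
    rw [hP]
    exact hQ j (by omega)


/-- projective dimension of `R ⧸ J` at most `n`. -/
def PD {R : Type} [CommRing R] (J : Ideal R) (n : ℕ) : Prop :=
  HasProjectiveDimensionLE (ModuleCat.of R (R ⧸ J)) n

lemma PD.mono {R : Type} [CommRing R] {J : Ideal R} {m n : ℕ} (h : PD J m) (hmn : m ≤ n) :
    PD J n := by
  unfold PD at *
  exact hasProjectiveDimensionLT_of_ge _ (m + 1) (n + 1) (by omega)

section T1
variable {R : Type} [CommRing R] {J J' K : Ideal R} {c : R}

lemma colon_ses (h1 : ∀ u, u ∈ J' ↔ u * c ∈ J) (h2 : K = J ⊔ Ideal.span {c}) :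
    ∃ S : ShortComplex (ModuleCat R), S.ShortExact ∧ S.X₁ = ModuleCat.of R (R ⧸ J') ∧
      S.X₂ = ModuleCat.of R (R ⧸ J) ∧ S.X₃ = ModuleCat.of R (R ⧸ K) := by
  have hf : J' ≤ Submodule.comap (LinearMap.mulRight R c) J := fun u hu => (h1 u).1 hu
  have hJK : J ≤ K := h2 ▸ le_sup_left
  let f : (R ⧸ J') →ₗ[R] (R ⧸ J) := Submodule.mapQ J' J (LinearMap.mulRight R c) hf
  let g : (R ⧸ J) →ₗ[R] (R ⧸ K) := Submodule.mapQ J K LinearMap.id hJK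
  have hfinj : Function.Injective f := by
    rw [injective_iff_map_eq_zero]
    intro x
    obtain ⟨u, rfl⟩ := Submodule.Quotient.mk_surjective _ x
    intro hx
    have : Submodule.Quotient.mk (p := J) (u * c) = 0 := hx
    rw [Submodule.Quotient.mk_eq_zero] at this
    exact (Submodule.Quotient.mk_eq_zero _).2 ((h1 u).2 this)
  have hgsurj : Function.Surjective g := by
    intro x
    obtain ⟨u, rfl⟩ := Submodule.Quotient.mk_surjective _ x
    exact ⟨Submodule.Quotient.mk u, rfl⟩
  have hex : Function.Exact f g := by
    intro y
    obtain ⟨v, rfl⟩ := Submodule.Quotient.mk_surjective _ y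
    have e : g (Submodule.Quotient.mk v) = Submodule.Quotient.mk (p := K) v := rfl
    rw [e, Submodule.Quotient.mk_eq_zero]
    constructor
    · intro hv
      rw [h2] at hv
      obtain ⟨a, ha, b, hb, rfl⟩ := Submodule.mem_sup.1 hv
      obtain ⟨u, rfl⟩ := Ideal.mem_span_singleton'.1 hb
      refine ⟨Submodule.Quotient.mk u, ?_⟩
      show Submodule.Quotient.mk (p := J) (u * c) = _
      rw [Submodule.Quotient.eq]
      have : u * c - (a + u * c) = -a := by ring
      rw [this]
      exact neg_mem ha
    · rintro ⟨x, hx⟩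
      obtain ⟨u, rfl⟩ := Submodule.Quotient.mk_surjective _ x
      have hx' : Submodule.Quotient.mk (p := J) (u * c) = Submodule.Quotient.mk v := hx
      rw [Submodule.Quotient.eq] at hx'
      have : v = u * c - (u * c - v) := by ring
      rw [this]
      refine sub_mem ?_ (hJK hx')
      rw [h2]
      exact Ideal.mul_mem_left _ _ (Ideal.mem_sup_right (Ideal.mem_span_singleton_self c))
  have hcomp : ModuleCat.ofHom f ≫ ModuleCat.ofHom g = 0 := by
    apply ModuleCat.hom_ext
    apply LinearMap.ext
    intro x
    exact (hex (f x)).2 ⟨x, rfl⟩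
  refine ⟨ShortComplex.mk (ModuleCat.ofHom f) (ModuleCat.ofHom g) hcomp, ?_, rfl, rfl, rfl⟩
  exact
    { exact := (ShortComplex.ShortExact.moduleCat_exact_iff_function_exact _).2 hex
      mono_f := (ModuleCat.mono_iff_injective _).2 hfinj
      epi_g := (ModuleCat.epi_iff_surjective _).2 hgsurj }

lemma PD.sup {n : ℕ} (h1 : ∀ u, u ∈ J' ↔ u * c ∈ J) (h2 : K = J ⊔ Ideal.span {c})
    (p1 : PD J' n) (p2 : PD J (n + 1)) : PD K (n + 1) := by
  obtain ⟨S, hS, e1, e2, e3⟩ := colon_ses h1 h2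
  unfold PD at *
  rw [← e1] at p1
  rw [← e2] at p2
  rw [← e3]
  exact hS.hasProjectiveDimensionLT_X₃ (n + 1) p1 p2

lemma PD.mid {n : ℕ} (h1 : ∀ u, u ∈ J' ↔ u * c ∈ J) (h2 : K = J ⊔ Ideal.span {c})
    (p1 : PD J' n) (p2 : PD K n) : PD J n := by
  obtain ⟨S, hS, e1, e2, e3⟩ := colon_ses h1 h2
  unfold PD at *
  rw [← e1] at p1
  rw [← e3] at p2
  rw [← e2]
  exact hS.hasProjectiveDimensionLT_X₂ (n + 1) p1 p2

end T1

lemma PD.bot {R : Type} [CommRing R] : PD (⊥ : Ideal R) 0 := by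
  unfold PD
  rw [← projective_iff_hasProjectiveDimensionLE_zero]
  have : Module.Free R (R ⧸ (⊥ : Ideal R)) :=
    Module.Free.of_equiv (Submodule.quotEquivOfEqBot (⊥ : Ideal R) rfl).symm
  infer_instance

section UFD
variable {R : Type} [CommRing R] [IsDomain R] 

lemma PD.single (f : R) : PD (Ideal.span {f}) 1 := by
  by_cases hf : f = 0
  · subst hf
    rw [Ideal.span_singleton_eq_bot.2 rfl]
    exact PD.bot.mono (by omega)
  · refine PD.sup (J := ⊥) (J' := ⊥) (c := f) ?_ (by simp) PD.bot (PD.bot.mono (by omega))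
    intro u
    simp [hf]

/-- multiplication of an ideal by a nonzero element -/
lemma PD.smul {f : R} (hf : f ≠ 0) {J K : Ideal R} {n : ℕ} (h : PD K (n + 1))
    (hJ : ∀ u, u ∈ J ↔ ∃ v ∈ K, u = v * f) : PD J (n + 1) := by
  refine PD.mid (J' := K) (c := f) (K := Ideal.span {f}) ?_ ?_ h ((PD.single f).mono (by omega))
  · intro u
    rw [hJ]
    constructor
    · intro hu
      exact ⟨u, hu, rfl⟩
    · rintro ⟨v, hv, e⟩
      rwa [mul_right_cancel₀ hf e]
  · apply le_antisymm le_sup_right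
    refine sup_le ?_ le_rfl
    intro u hu
    obtain ⟨v, -, rfl⟩ := (hJ u).1 hu
    exact Ideal.mul_mem_left _ _ (Ideal.mem_span_singleton_self f)

variable [UniqueFactorizationMonoid R]

lemma exists_gcd (f g : R) (h : ¬ (f = 0 ∧ g = 0)) :
    ∃ d a b : R, d ≠ 0 ∧ f = a * d ∧ g = b * d ∧ IsRelPrime a b := by
  classical
  let _ : GCDMonoid R := UniqueFactorizationMonoid.toGCDMonoid R
  have hd : GCDMonoid.gcd f g ≠ 0 := fun h' => h ((gcd_eq_zero_iff f g).1 h')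
  obtain ⟨a, ha⟩ := GCDMonoid.gcd_dvd_left f g
  obtain ⟨b, hb⟩ := GCDMonoid.gcd_dvd_right f g
  refine ⟨GCDMonoid.gcd f g, a, b, hd, by rw [mul_comm]; exact ha, by rw [mul_comm]; exact hb, ?_⟩
  intro e hea heb
  have h1 : GCDMonoid.gcd f g * e ∣ GCDMonoid.gcd f g :=
    GCDMonoid.dvd_gcd (by conv_rhs => rw [ha]
                          exact mul_dvd_mul_left _ hea)
      (by conv_rhs => rw [hb]
          exact mul_dvd_mul_left _ heb)
  obtain ⟨x, hx⟩ := h1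
  have : GCDMonoid.gcd f g * (e * x) = GCDMonoid.gcd f g * 1 := by
    rw [mul_one, ← mul_assoc]; exact hx.symm
  exact IsUnit.of_mul_eq_one _ (mul_left_cancel₀ hd this)

lemma exists_gcd3 (f g h : R) (hf : f ≠ 0) :
    ∃ d a b c : R, d ≠ 0 ∧ f = a * d ∧ g = b * d ∧ h = c * d ∧
      ∀ e, e ∣ a → e ∣ b → e ∣ c → IsUnit e := by
  obtain ⟨d, a, b, hd, rfl, rfl, hab⟩ := exists_gcd f g (fun h => hf h.1)
  obtain ⟨e, d', c, he, rfl, rfl, hc⟩ := exists_gcd d h (fun h => hd h.1)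
  refine ⟨e, a * d', b * d', c, he, by ring, by ring, rfl, ?_⟩
  intro x hx hy hz
  refine hc ?_ hz
  classical
  let _ : GCDMonoid R := UniqueFactorizationMonoid.toGCDMonoid R
  have h2 : x ∣ GCDMonoid.gcd (a * d') (b * d') := GCDMonoid.dvd_gcd hx hy
  have h3 := (gcd_mul_right' d' a b)
  have h4 : IsUnit (GCDMonoid.gcd a b) :=
    hab (GCDMonoid.gcd_dvd_left a b) (GCDMonoid.gcd_dvd_right a b)
  exact (h2.trans h3.dvd).trans (h4.mul_left_dvd.2 dvd_rfl)

lemma PD.pair (f g : R) : PD (Ideal.span {f, g}) 2 := by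
  by_cases h : f = 0 ∧ g = 0
  · obtain ⟨rfl, rfl⟩ := h
    have : Ideal.span {(0 : R), 0} = ⊥ := by simp
    rw [this]
    exact PD.bot.mono (by omega)
  obtain ⟨d, a, b, hd, rfl, rfl, hab⟩ := exists_gcd f g h
  refine PD.smul hd (K := Ideal.span {a, b}) ?_ ?_
  · refine PD.sup (J := Ideal.span {a}) (J' := Ideal.span {a}) (c := b) ?_ ?_ (PD.single a)
      ((PD.single a).mono (by omega))
    · intro u
      rw [Ideal.mem_span_singleton, Ideal.mem_span_singleton]
      exact ⟨fun h => h.mul_right _, fun h => hab.dvd_of_dvd_mul_right h⟩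
    · rw [Ideal.span_insert]
  · intro u
    simp only [Ideal.mem_span_pair]
    constructor
    · rintro ⟨x, y, rfl⟩
      exact ⟨x * a + y * b, ⟨x, y, rfl⟩, by ring⟩
    · rintro ⟨v, ⟨x, y, rfl⟩, rfl⟩
      exact ⟨x, y, by ring⟩

end UFD

lemma mem_span_triple {R : Type*} [CommRing R] {x y z u : R} :
    u ∈ Ideal.span {x, y, z} ↔ ∃ a b c, a * x + b * y + c * z = u := by
  rw [Ideal.mem_span_insert]
  simp only [Ideal.mem_span_pair]
  constructor
  · rintro ⟨a, _, ⟨b, c, rfl⟩, rfl⟩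
    exact ⟨a, b, c, by ring⟩
  · rintro ⟨a, b, c, rfl⟩
    exact ⟨a, _, ⟨b, c, rfl⟩, by ring⟩


section Homog
variable {k : Type} [Field k] {N : ℕ}

local notation "RR" => MvPolynomial (Fin N) k

/-- the grading homomorphism -/
def gradeHom : RR →ₐ[k] Polynomial RR :=
  MvPolynomial.aeval (fun i => Polynomial.C (X i) * Polynomial.X)

lemma gradeHom_homog {f : RR} {d : ℕ} (hf : f.IsHomogeneous d) :
    gradeHom f = Polynomial.C f * Polynomial.X ^ d := by
  conv_lhs => rw [f.as_sum]
  conv_rhs => rw [f.as_sum]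
  rw [map_sum, map_sum, Finset.sum_mul]
  refine Finset.sum_congr rfl fun v hv => ?_
  have hd : v.degree = d := (hf.degree_eq_sum_deg_support hv).symm
  unfold gradeHom
  rw [aeval_monomial]
  have e1 : (v.prod fun i e => (Polynomial.C (X i : RR) * Polynomial.X) ^ e) =
      Polynomial.C (v.prod fun i e => (X i : RR) ^ e) * Polynomial.X ^ d := by
    rw [← hd, Finsupp.degree]
    simp only [mul_pow, Finsupp.prod_mul]
    congr 1
    · simp only [Finsupp.prod, map_prod, map_pow]
    · simp only [Finsupp.prod, Finset.prod_pow_eq_pow_sum]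
      rfl
  rw [e1, MvPolynomial.monomial_eq, map_mul, mul_assoc]
  rfl

lemma gradeHom_coeff (f : RR) (d : ℕ) :
    (gradeHom f).coeff d = homogeneousComponent d f := by
  conv_lhs => rw [← sum_homogeneousComponent f]
  rw [map_sum, Polynomial.finsetSum_coeff]
  have : ∀ i, (gradeHom (homogeneousComponent i f)).coeff d =
      if d = i then homogeneousComponent d f else 0 := by
    intro i
    rw [gradeHom_homog (homogeneousComponent_isHomogeneous i f), Polynomial.coeff_C_mul_X_pow]
    split_ifs with h
    · rw [h]
    · rfl
  simp only [this]
  rw [Finset.sum_ite_eq]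
  split_ifs with h
  · rfl
  · rw [homogeneousComponent_eq_zero]
    simp at h
    omega

lemma gradeHom_inj (f : RR) (hf : gradeHom f = 0) : f = 0 := by
  rw [← sum_homogeneousComponent f]
  refine Finset.sum_eq_zero fun i _ => ?_
  rw [← gradeHom_coeff, hf, Polynomial.coeff_zero]

lemma homog_of_mul {f g : RR} {n : ℕ} (h : (f * g).IsHomogeneous n) (h0 : f * g ≠ 0) :
    ∃ i j, i + j = n ∧ f.IsHomogeneous i ∧ g.IsHomogeneous j := by
  have hf : gradeHom f ≠ 0 := fun h => h0 (by rw [gradeHom_inj f h, zero_mul])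
  have hg : gradeHom g ≠ 0 := fun h => h0 (by rw [gradeHom_inj g h, mul_zero])
  have e := gradeHom_homog h
  rw [map_mul] at e
  have e1 : (gradeHom f).natDegree + (gradeHom g).natDegree = n := by
    rw [← Polynomial.natDegree_mul hf hg, e, Polynomial.natDegree_C_mul_X_pow _ _ h0]
  have e2 : (gradeHom f).natTrailingDegree + (gradeHom g).natTrailingDegree = n := by
    rw [← Polynomial.natTrailingDegree_mul hf hg, e, Polynomial.C_mul_X_pow_eq_monomial,
      Polynomial.natTrailingDegree_monomial h0]
  have l1 := Polynomial.natTrailingDegree_le_natDegree (gradeHom f)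
  have l2 := Polynomial.natTrailingDegree_le_natDegree (gradeHom g)
  have key : ∀ f : RR, (gradeHom f).natTrailingDegree = (gradeHom f).natDegree →
      f.IsHomogeneous (gradeHom f).natDegree := by
    intro f hf
    have : f = homogeneousComponent (gradeHom f).natDegree f := by
      conv_lhs => rw [← sum_homogeneousComponent f]
      have hz : ∀ i, i ≠ (gradeHom f).natDegree → homogeneousComponent i f = 0 := by
        intro i hi
        rw [← gradeHom_coeff]
        rcases lt_or_gt_of_ne hi with h | h
        · exact Polynomial.coeff_eq_zero_of_lt_natTrailingDegree (hf ▸ h)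
        · exact Polynomial.coeff_eq_zero_of_natDegree_lt h
      rw [Finset.sum_eq_single (gradeHom f).natDegree (fun i _ hi => hz i hi)]
      intro hn
      apply homogeneousComponent_eq_zero
      simp at hn
      omega
    have h2 := homogeneousComponent_isHomogeneous (gradeHom f).natDegree f
    rwa [← this] at h2
  exact ⟨_, _, e1, key f (by omega), key g (by omega)⟩

lemma homog_comp_mul {f g : RR} {d e : ℕ} (hf : f.IsHomogeneous d) :
    homogeneousComponent (d + e) (f * g) = f * homogeneousComponent e g := by
  rw [← gradeHom_coeff, map_mul, gradeHom_homog hf, mul_assoc, Polynomial.coeff_C_mul,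
    ← gradeHom_coeff, add_comm, mul_comm (Polynomial.X ^ d), Polynomial.coeff_mul_X_pow]

lemma homog_zero_unit {f : RR} (hf : f.IsHomogeneous 0) (h0 : f ≠ 0) : IsUnit f := by
  have := (totalDegree_zero_iff_isHomogeneous _).2 hf
  rw [MvPolynomial.totalDegree_eq_zero_iff_eq_C] at this
  rw [this] at h0 ⊢
  have : coeff 0 f ≠ 0 := fun h => h0 (by rw [h, map_zero])
  exact (isUnit_iff_ne_zero.2 this).map C

lemma homog_not_unit {f : RR} {d : ℕ} (hf : f.IsHomogeneous d) (hd : d ≠ 0) : ¬ IsUnit f := by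
  intro h
  have h1 := MvPolynomial.isUnit_iff_totalDegree_of_isReduced.1 h
  have := hf.totalDegree h.ne_zero
  omega

lemma linear_form {m : RR} (hm : m.IsHomogeneous 1) : ∃ a : Fin N → k, m = ∑ j, C (a j) * X j := by
  have : m ∈ homogeneousSubmodule (Fin N) k 1 := hm
  rw [homogeneousSubmodule_one_eq_span_X, Submodule.mem_span_range_iff_exists_fun] at this
  obtain ⟨a, ha⟩ := this
  exact ⟨a, by rw [← ha]; simp [MvPolynomial.smul_eq_C_mul]⟩

lemma exists_proj {m : RR} (hm : m.IsHomogeneous 1) (h0 : m ≠ 0) :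
    ∃ π : RR →ₐ[k] RR, π m = 0 ∧ (∀ r, π (π r) = π r) ∧ (∀ r, ∃ r', r = π r + m * r') ∧
      ∀ f d, f.IsHomogeneous d → (π f).IsHomogeneous d := by
  obtain ⟨a, ha⟩ := linear_form hm
  obtain ⟨i, hi⟩ : ∃ i, a i ≠ 0 := by
    by_contra hcon
    push Not at hcon
    apply h0
    rw [ha]
    simp [hcon]
  let π : RR →ₐ[k] RR := aeval (fun j => X j - if j = i then C (a i)⁻¹ * m else 0)
  have hπX : ∀ j, π (X j) = X j - if j = i then C (a i)⁻¹ * m else 0 := fun j => aeval_X _ _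
  have hπC : ∀ c, π (C c) = C c := fun c => by simp [π]
  have h1 : π m = 0 := by
    have : π m = m - C (a i) * (C (a i)⁻¹ * m) := by
      conv_lhs => rw [ha]
      rw [map_sum]
      simp only [map_mul, hπX, hπC, mul_sub, Finset.sum_sub_distrib]
      rw [← ha]
      congr 1
      rw [Finset.sum_eq_single i]
      · simp
      · intro j _ hj
        simp [hj]
      · simp
    rw [this, ← mul_assoc, ← C_mul, mul_inv_cancel₀ hi]
    simp
  have h2 : ∀ r, ∃ r', r = π r + m * r' := by
    intro r
    have key : (Ideal.Quotient.mkₐ k (Ideal.span {m})).comp π =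
        Ideal.Quotient.mkₐ k (Ideal.span {m}) := by
      apply MvPolynomial.algHom_ext
      intro j
      rw [AlgHom.comp_apply, hπX]
      show Ideal.Quotient.mk _ _ = Ideal.Quotient.mk _ _
      rw [Ideal.Quotient.eq]
      split_ifs
      · rw [sub_sub_cancel_left]
        exact neg_mem (Ideal.mul_mem_left _ _ (Ideal.mem_span_singleton_self m))
      · simp
    have := DFunLike.congr_fun key r
    have h3 : Ideal.Quotient.mk (Ideal.span {m}) (π r) = Ideal.Quotient.mk _ r := this
    rw [eq_comm, Ideal.Quotient.eq, Ideal.mem_span_singleton] at h3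
    obtain ⟨r', hr'⟩ := h3
    exact ⟨r', by rw [← hr']; ring⟩
  refine ⟨π, h1, ?_, h2, ?_⟩
  · intro r
    obtain ⟨r', hr'⟩ := h2 r
    conv_rhs => rw [hr']
    rw [map_add, map_mul, h1, zero_mul, add_zero]
  · intro f d hf
    have := hf.aeval (n := 1) (fun j => X j - if j = i then C (a i)⁻¹ * m else 0) ?_
    · rwa [one_mul] at this
    · intro j
      refine (isHomogeneous_X _ _).sub ?_
      split_ifs
      · exact hm.C_mul _
      · exact isHomogeneous_zero _ _ _

end Homog

section Lin
variable {k : Type} [Field k] {N : ℕ}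

local notation "RR" => MvPolynomial (Fin N) k

lemma PD.lin {m : RR} (h0 : m ≠ 0) {π : RR →ₐ[k] RR} (p1 : π m = 0) (p2 : ∀ r, π (π r) = π r)
    (p3 : ∀ r, ∃ r', r = π r + m * r') (S : Set RR) {n : ℕ}
    (h : PD (Ideal.span (π '' S)) n) : PD (Ideal.span S ⊔ Ideal.span {m}) (n + 1) := by
  have e : Ideal.span S ⊔ Ideal.span {m} = Ideal.span (π '' S) ⊔ Ideal.span {m} := by
    have hm : ∀ I : Ideal RR, ∀ r, m * r ∈ I ⊔ Ideal.span {m} := fun I r =>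
      Ideal.mem_sup_right (Ideal.mul_mem_right _ _ (Ideal.mem_span_singleton_self m))
    apply le_antisymm
    · refine sup_le (Ideal.span_le.2 ?_) le_sup_right
      intro s hs
      obtain ⟨r', hr'⟩ := p3 s
      rw [hr']
      exact add_mem (Ideal.mem_sup_left (Ideal.subset_span ⟨s, hs, rfl⟩)) (hm _ _)
    · refine sup_le (Ideal.span_le.2 ?_) le_sup_right
      rintro _ ⟨s, hs, rfl⟩
      obtain ⟨r', hr'⟩ := p3 s
      have : π s = s - m * r' := by rw [eq_sub_iff_add_eq]; exact hr'.symm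
      rw [this]
      exact sub_mem (Ideal.mem_sup_left (Ideal.subset_span hs)) (hm _ _)
  rw [e]
  have key : ∀ x ∈ Ideal.span (π '' S), ∃ y ∈ Ideal.span (π '' S), x - π x = m * y := by
    intro x hx
    induction hx using Submodule.span_induction with
    | mem s hs =>
      obtain ⟨s, hs, rfl⟩ := hs
      exact ⟨0, zero_mem _, by rw [p2]; ring⟩
    | zero => exact ⟨0, zero_mem _, by simp⟩
    | add x y hx hy ihx ihy =>
      obtain ⟨u, hu, hu'⟩ := ihx
      obtain ⟨v, hv, hv'⟩ := ihy
      refine ⟨u + v, add_mem hu hv, ?_⟩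
      rw [map_add, mul_add, ← hu', ← hv']
      ring
    | smul a x hx ih =>
      obtain ⟨y, hy, hy'⟩ := ih
      obtain ⟨a', ha'⟩ := p3 a
      have hx' : π x = x - m * y := by rw [← hy']; ring
      refine ⟨a * y + a' * π x, add_mem (Ideal.mul_mem_left _ _ hy) (Ideal.mul_mem_left _ _ ?_), ?_⟩
      · rw [hx']
        exact sub_mem hx (Ideal.mul_mem_left _ _ hy)
      · rw [smul_eq_mul, map_mul]
        linear_combination (a) * hy' + (π x) * ha'
  refine PD.sup (J' := Ideal.span (π '' S)) (c := m) (fun u => ⟨fun hu => Ideal.mul_mem_right _ _ hu, ?_⟩)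
    rfl h (h.mono (by omega))
  intro hu
  obtain ⟨y, hy, hy'⟩ := key _ hu
  rw [map_mul, p1, mul_zero, sub_zero, mul_comm] at hy'
  rwa [mul_left_cancel₀ h0 hy']

lemma PD.lin3 {m : RR} (hm : m.IsHomogeneous 1) (f g : RR) : PD (Ideal.span {m, f, g}) 3 := by
  by_cases h0 : m = 0
  · subst h0
    have : Ideal.span {0, f, g} = Ideal.span {f, g} := Ideal.span_insert_zero
    rw [this]
    exact (PD.pair f g).mono (by omega)
  · obtain ⟨π, p1, p2, p3, -⟩ := exists_proj hm h0
    have := PD.lin h0 p1 p2 p3 {f, g} (n := 2) (by rw [Set.image_pair]; exact PD.pair _ _)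
    rwa [sup_comm, ← Ideal.span_insert] at this

end Lin

section Det
variable {R : Type} [CommRing R] [IsDomain R] [UniqueFactorizationMonoid R]

lemma dvd_of_gcd3 {q c h p1 p3 p2 : R} (hq : q ≠ 0)
    (hg : ∀ e, e ∣ q → e ∣ c → e ∣ h → IsUnit e) (h1 : p2 * c = p1 * q) (h3 : p2 * h = p3 * q) :
    q ∣ p2 := by
  classical
  let _ : GCDMonoid R := UniqueFactorizationMonoid.toGCDMonoid R
  obtain ⟨d, a, b, hd, e1, e2, hab⟩ := exists_gcd q p2 (fun h => hq h.1)
  have ha : IsUnit a := by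
    apply hg
    · exact ⟨d, e1⟩
    · apply hab.dvd_of_dvd_mul_left
      refine ⟨p1, mul_right_cancel₀ hd ?_⟩
      rw [e2, e1] at h1
      linear_combination h1
    · apply hab.dvd_of_dvd_mul_left
      refine ⟨p3, mul_right_cancel₀ hd ?_⟩
      rw [e2, e1] at h3
      linear_combination h3
  obtain ⟨a', ha'⟩ := ha.exists_left_inv
  refine ⟨a' * b, ?_⟩
  rw [e1, e2]
  linear_combination (-b * d) * ha'

lemma PD.det {g u l s α t : R} (hq : g * u + l * s ≠ 0)
    (hg : ∀ e, e ∣ g * u + l * s → e ∣ g * α + l * t → e ∣ α * s - u * t → IsUnit e) :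
    PD (Ideal.span {g * u + l * s, g * α + l * t, α * s - u * t}) 3 := by
  set q := g * u + l * s with hqd
  set c := g * α + l * t with hcd
  set h := α * s - u * t with hhd
  refine PD.sup (J' := Ideal.span {α, t}) (J := Ideal.span {c, h}) (c := q) ?_ ?_ (PD.pair _ _)
    ((PD.pair _ _).mono (by omega))
  · intro z
    constructor
    · intro hz
      obtain ⟨a, b, rfl⟩ := Ideal.mem_span_pair.1 hz
      rw [Ideal.mem_span_pair]
      exact ⟨a * u + b * s, a * l - b * g, by rw [hqd, hcd, hhd]; ring⟩
    · intro hz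
      obtain ⟨y, x, hyx⟩ := Ideal.mem_span_pair.1 hz
      -- Z = (-y, z, -x), v = (-u, α, -l), w = (-s,t,g)
      -- Z × v second = Z3 v1 - Z1 v3
      have r1 : α * q - u * c = l * h := by rw [hqd, hcd, hhd]; ring
      have r2 : t * q - s * c = -g * h := by rw [hqd, hcd, hhd]; ring
      obtain ⟨β, hβ⟩ : q ∣ x * u - y * l := by
        apply dvd_of_gcd3 hq hg (p1 := z * (-l) + x * α) (p3 := -y * α + z * u)
        · linear_combination (-l) * hyx - x * r1
        · linear_combination u * hyx + y * r1
      obtain ⟨γ, hγ⟩ : q ∣ x * s + y * g := by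
        apply dvd_of_gcd3 hq hg (p1 := z * g + x * t) (p3 := -y * t + z * s)
        · linear_combination g * hyx - x * r2
        · linear_combination s * hyx + y * r2
      rw [Ideal.mem_span_pair]
      refine ⟨γ, -β, ?_⟩
      apply mul_right_cancel₀ hq
      have r3 : x * h + y * c = (x * s + y * g) * α - (x * u - y * l) * t := by
        rw [hcd, hhd]; ring
      linear_combination (-α) * hγ + t * hβ + hyx - r3
  · rw [sup_comm, ← Ideal.span_insert]
end Det

section Case1
variable {k : Type} [Field k] {N : ℕ}

local notation "RR" => MvPolynomial (Fin N) k

lemma PD.K3 {g u l s α t : RR} (hh : (g * u + l * s).IsHomogeneous 2) :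
    PD (Ideal.span {g * u + l * s, g * α + l * t, α * s - u * t}) 3 := by
  by_cases h0 : g * u + l * s = 0
  · rw [h0, Ideal.span_insert_zero]
    exact (PD.pair _ _).mono (by omega)
  obtain ⟨d, a, b, c, hd, e1, e2, e3, hu⟩ := exists_gcd3 _ (g * α + l * t) (α * s - u * t) h0
  rw [e1] at hh h0
  obtain ⟨i, j, hij, ha, hd'⟩ := homog_of_mul hh h0
  have hsm : ∀ n, PD (Ideal.span {a, b, c}) (n + 1) →
      PD (Ideal.span {g * u + l * s, g * α + l * t, α * s - u * t}) (n + 1) := by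
    intro n hn
    refine PD.smul hd hn ?_
    intro z
    rw [e1, e2, e3, mem_span_triple]
    constructor
    · rintro ⟨x, y, w, rfl⟩
      exact ⟨x * a + y * b + w * c, mem_span_triple.2 ⟨x, y, w, rfl⟩, by ring⟩
    · rintro ⟨v, hv, rfl⟩
      obtain ⟨x, y, w, rfl⟩ := mem_span_triple.1 hv
      exact ⟨x, y, w, by ring⟩
  have : j = 0 ∨ i = 1 ∨ i = 0 := by omega
  rcases this with rfl | rfl | rfl
  · have hdu : IsUnit d := homog_zero_unit hd' hd
    refine PD.det (e1 ▸ h0) ?_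
    rw [e1, e2, e3]
    intro e h1 h2 h3
    rw [hdu.dvd_mul_right] at h1 h2 h3
    exact hu e h1 h2 h3
  · exact hsm 2 (PD.lin3 ha b c)
  · apply hsm 2
    have : Ideal.span {a, b, c} = Ideal.span {1} := by
      rw [Ideal.span_singleton_one]
      exact Ideal.eq_top_of_isUnit_mem _ (Ideal.subset_span (by simp))
        (homog_zero_unit ha (fun h => h0 (by rw [h, zero_mul])))
    rw [this]
    exact (PD.single 1).mono (by omega)

lemma PD.case1 {l m q c : RR} (hl : l.IsHomogeneous 1) (hm : m.IsHomogeneous 1)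
    (hq : q.IsHomogeneous 2) : PD (Ideal.span {l * m, q, c}) 4 := by
  by_cases h0 : l * m = 0
  · rw [h0, Ideal.span_insert_zero]
    exact (PD.pair _ _).mono (by omega)
  have hl0 : l ≠ 0 := left_ne_zero_of_mul h0
  have hm0 : m ≠ 0 := right_ne_zero_of_mul h0
  obtain ⟨π, p1, p2, p3, -⟩ := exists_proj hl hl0
  obtain ⟨s, hs⟩ := p3 q
  obtain ⟨t, ht⟩ := p3 c
  have hK : Ideal.span {l, q, c} = Ideal.span {l * m, q, c} ⊔ Ideal.span {l} := by
    rw [sup_comm, ← Ideal.span_insert]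
    apply le_antisymm
    · apply Ideal.span_mono
      intro x hx
      simp only [Set.mem_insert_iff, Set.mem_singleton_iff] at hx ⊢
      tauto
    · rw [Ideal.span_le]
      intro x hx
      simp only [Set.mem_insert_iff, Set.mem_singleton_iff] at hx
      rcases hx with rfl | rfl | rfl | rfl
      · exact Ideal.subset_span (by simp)
      · exact Ideal.mul_mem_right _ _ (Ideal.subset_span (by simp))
      · exact Ideal.subset_span (by simp)
      · exact Ideal.subset_span (by simp)
  have p1' : PD (Ideal.span {l, q, c}) 4 := (PD.lin3 hl q c).mono (by omega)
  by_cases hz : π q = 0 ∧ π c = 0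
  · rw [hz.1, zero_add] at hs
    rw [hz.2, zero_add] at ht
    refine PD.mid (J' := Ideal.span {m, s, t}) (c := l) ?_ hK ((PD.lin3 hm s t).mono (by omega)) p1'
    intro u
    rw [mem_span_triple, mem_span_triple]
    constructor
    · rintro ⟨x, y, z, rfl⟩
      exact ⟨x, y, z, by rw [hs, ht]; ring⟩
    · rintro ⟨x, y, z, h⟩
      refine ⟨x, y, z, mul_right_cancel₀ hl0 ?_⟩
      rw [← h, hs, ht]
      ring
  obtain ⟨g, u, α, hg0, e1, e2, hrel⟩ := exists_gcd (π q) (π c) hz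
  refine PD.mid (J' := Ideal.span {q, c, α * s - u * t} ⊔ Ideal.span {m}) (c := l) ?_ hK ?_ p1'
  · intro f
    constructor
    · intro hf
      obtain ⟨r, hr, w, hw, rfl⟩ := Submodule.mem_sup.1 hf
      obtain ⟨x, y, z, rfl⟩ := mem_span_triple.1 hr
      obtain ⟨w, rfl⟩ := Ideal.mem_span_singleton'.1 hw
      rw [mem_span_triple]
      refine ⟨w, x * l + z * α, y * l - z * u, ?_⟩
      linear_combination (z * α) * hs - (z * u) * ht + z * α * e1 - z * u * e2
    · intro hf
      obtain ⟨A, B, C', h⟩ := mem_span_triple.1 hf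
      have h' := congrArg π h
      simp only [map_add, map_mul, p1, zero_mul, mul_zero, zero_add] at h'
      rw [e1, e2] at h'
      have h2 : π B * u + π C' * α = 0 := by
        apply mul_right_cancel₀ hg0
        linear_combination h'
      obtain ⟨e, he1, he2⟩ : ∃ e, π B = - α * e ∧ π C' = u * e := by
        by_cases hu : u = 0
        · subst hu
          obtain ⟨α', hα'⟩ := (isRelPrime_zero_left.1 hrel).exists_left_inv
          refine ⟨- α' * π B, ?_, ?_⟩
          · linear_combination (-π B) * hα'
          · linear_combination (-π C') * hα' + α' * h2
        · have : u ∣ π C' := by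
            classical
            let _ : GCDMonoid RR := UniqueFactorizationMonoid.toGCDMonoid _
            apply hrel.dvd_of_dvd_mul_right
            exact ⟨- π B, by linear_combination h2⟩
          obtain ⟨e, he⟩ := this
          refine ⟨e, mul_left_cancel₀ hu ?_, he⟩
          rw [he] at h2
          linear_combination h2
      obtain ⟨B', hB⟩ := p3 B
      obtain ⟨C'', hC⟩ := p3 C'
      rw [Submodule.mem_sup]
      refine ⟨B' * q + C'' * c + (-e) * (α * s - u * t), mem_span_triple.2 ⟨_, _, _, rfl⟩, A * m,
        Ideal.mul_mem_left _ _ (Ideal.mem_span_singleton_self m), ?_⟩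
      apply mul_left_cancel₀ hl0
      rw [he1] at hB
      rw [he2] at hC
      rw [e1] at hs
      rw [e2] at ht
      linear_combination h - q * hB - c * hC + α * e * hs - u * e * ht
  · obtain ⟨ρ, r1, r2, r3, r4⟩ := exists_proj hm hm0
    refine PD.lin hm0 r1 r2 r3 _ ?_
    rw [Set.image_insert_eq, Set.image_insert_eq, Set.image_singleton]
    have hq' : ρ q = ρ g * ρ u + ρ l * ρ s := by
      rw [hs, e1, map_add, map_mul, map_mul]; ring
    have hc' : ρ c = ρ g * ρ α + ρ l * ρ t := by
      rw [ht, e2, map_add, map_mul, map_mul]; ring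
    rw [hq', hc', map_sub, map_mul, map_mul]
    apply PD.K3
    rw [← hq']
    exact r4 _ _ hq

end Case1

section Zero
variable {k : Type} [Field k] {N : ℕ}

local notation "RR" => MvPolynomial (Fin N) k

/-- every nontrivial member of the pencil is irreducible -/
def AllIrr (q1 q2 : RR) : Prop := ∀ a b : k, (a ≠ 0 ∨ b ≠ 0) → Irreducible (C a * q1 + C b * q2)

lemma not_irr_quad {q : RR} (hq : q.IsHomogeneous 2) (h : ¬ Irreducible q) :
    ∃ l m : RR, l.IsHomogeneous 1 ∧ m.IsHomogeneous 1 ∧ q = l * m := by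
  by_cases h0 : q = 0
  · exact ⟨0, 0, isHomogeneous_zero _ _ _, isHomogeneous_zero _ _ _, by simp [h0]⟩
  rw [irreducible_iff] at h
  push Not at h
  obtain ⟨f, g, e, hf, hg⟩ := h (homog_not_unit hq (by norm_num))
  rw [e] at hq h0
  obtain ⟨i, j, hij, hi, hj⟩ := homog_of_mul hq h0
  have hi0 : i ≠ 0 := fun h => hf (homog_zero_unit (h ▸ hi) (left_ne_zero_of_mul h0))
  have hj0 : j ≠ 0 := fun h => hg (homog_zero_unit (h ▸ hj) (right_ne_zero_of_mul h0))
  have h1 : i = 1 := by omega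
  have h2 : j = 1 := by omega
  subst h1 h2
  exact ⟨f, g, hi, hj, e⟩

lemma not_irr_cubic {q : RR} (hq : q.IsHomogeneous 3) (h : ¬ Irreducible q) (h0 : q ≠ 0) :
    ∃ l m : RR, l.IsHomogeneous 1 ∧ m.IsHomogeneous 2 ∧ q = l * m := by
  rw [irreducible_iff] at h
  push Not at h
  obtain ⟨f, g, e, hf, hg⟩ := h (homog_not_unit hq (by norm_num))
  rw [e] at hq h0
  obtain ⟨i, j, hij, hi, hj⟩ := homog_of_mul hq h0
  have hi0 : i ≠ 0 := fun h => hf (homog_zero_unit (h ▸ hi) (left_ne_zero_of_mul h0))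
  have hj0 : j ≠ 0 := fun h => hg (homog_zero_unit (h ▸ hj) (right_ne_zero_of_mul h0))
  have : i = 1 ∨ i = 2 := by omega
  rcases this with rfl | rfl
  · have h2 : j = 2 := by omega
    subst h2
    exact ⟨f, g, hi, hj, e⟩
  · have h2 : j = 1 := by omega
    subst h2
    exact ⟨g, f, hj, hi, by rw [e, mul_comm]⟩

lemma irr_linear {l : RR} (hl : l.IsHomogeneous 1) (h0 : l ≠ 0) : Irreducible l := by
  rw [irreducible_iff]
  refine ⟨homog_not_unit hl (by norm_num), ?_⟩
  intro f g e
  rw [e] at hl h0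
  obtain ⟨i, j, hij, hi, hj⟩ := homog_of_mul hl h0
  have : i = 0 ∨ j = 0 := by omega
  rcases this with rfl | rfl
  · exact Or.inl (homog_zero_unit hi (left_ne_zero_of_mul h0))
  · exact Or.inr (homog_zero_unit hj (right_ne_zero_of_mul h0))

lemma pencil_homog {q1 q2 : RR} {d : ℕ} (h1 : q1.IsHomogeneous d) (h2 : q2.IsHomogeneous d) (a b : k) :
    (C a * q1 + C b * q2).IsHomogeneous d := (h1.C_mul a).add (h2.C_mul b)

lemma PD.reduce {q1 q2 c : RR} (h1 : q1.IsHomogeneous 2) (h2 : q2.IsHomogeneous 2)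
    (h : ¬ AllIrr q1 q2) : PD (Ideal.span {q1, q2, c}) 4 := by
  unfold AllIrr at h
  push Not at h
  obtain ⟨a, b, hab, hn⟩ := h
  obtain ⟨l, m, hl, hm, e⟩ := not_irr_quad (pencil_homog h1 h2 a b) hn
  rcases hab with ha | hb
  · have : Ideal.span {q1, q2, c} = Ideal.span {l * m, q2, c} := by
      have ha' : (C a⁻¹ * C a : RR) = 1 := by rw [← C_mul, inv_mul_cancel₀ ha, C_1]
      ext u
      rw [mem_span_triple, mem_span_triple]
      constructor
      · rintro ⟨x, y, z, rfl⟩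
        refine ⟨x * C a⁻¹, y - x * C a⁻¹ * C b, z, ?_⟩
        rw [← e]
        linear_combination (x * q1) * ha'
      · rintro ⟨x, y, z, rfl⟩
        refine ⟨x * C a, y + x * C b, z, ?_⟩
        rw [← e]
        ring
    rw [this]
    exact PD.case1 hl hm h2
  · have : Ideal.span {q1, q2, c} = Ideal.span {l * m, q1, c} := by
      have ha' : (C b⁻¹ * C b : RR) = 1 := by rw [← C_mul, inv_mul_cancel₀ hb, C_1]
      ext u
      rw [mem_span_triple, mem_span_triple]
      constructor
      · rintro ⟨x, y, z, rfl⟩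
        refine ⟨y * C b⁻¹, x - y * C b⁻¹ * C a, z, ?_⟩
        rw [← e]
        linear_combination (y * q2) * ha'
      · rintro ⟨x, y, z, rfl⟩
        refine ⟨y + x * C a, x * C b, z, ?_⟩
        rw [← e]
        ring
    rw [this]
    exact PD.case1 hl hm h1

lemma height_origin (M : Ideal RR) [M.IsPrime] (hM : ∀ f, eval 0 f = 0 → f ∈ M) :
    (N : ℕ∞) ≤ M.height := by
  let e : ℕ → (RR →ₐ[k] RR) := fun j => aeval (fun i : Fin N => if (i : ℕ) < j then 0 else X i)
  have hP : ∀ j, (RingHom.ker (e j)).IsPrime := fun j => RingHom.ker_isPrime _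
  have key : ∀ j, j ≤ N → (j : ℕ∞) ≤ (RingHom.ker (e j)).height := by
    intro j
    induction j with
    | zero => intro _; simp
    | succ j ih =>
      intro hj
      have hlt : RingHom.ker (e j) < RingHom.ker (e (j + 1)) := by
        refine lt_of_le_of_ne ?_ ?_
        · have hc : (e (j + 1)).comp (e j) = e (j + 1) := by
            apply MvPolynomial.algHom_ext
            intro i
            simp only [e, AlgHom.comp_apply, aeval_X]
            split_ifs with h1 h2 h2
            · simp
            · omega
            · rw [aeval_X, if_pos h2]
            · rw [aeval_X, if_neg h2]
          intro f hf
          rw [RingHom.mem_ker] at hf ⊢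
          rw [← hc, AlgHom.comp_apply, hf, map_zero]
        · intro he
          have h1 : (X ⟨j, hj⟩ : RR) ∈ RingHom.ker (e (j + 1)) := by
            rw [RingHom.mem_ker]; simp [e]
          rw [← he, RingHom.mem_ker] at h1
          simp [e] at h1
      have := hP j
      have := hP (j + 1)
      refine le_trans ?_ (Ideal.height_add_one_le_of_lt_of_isPrime hlt)
      push_cast
      gcongr
      exact ih (by omega)
  refine (key N le_rfl).trans (Ideal.height_mono ?_)
  intro f hf
  apply hM
  rw [RingHom.mem_ker] at hf
  have hc : (MvPolynomial.aeval (0 : Fin N → k)).comp (e N) = MvPolynomial.aeval (0 : Fin N → k) := by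
    apply MvPolynomial.algHom_ext
    intro i
    simp [e]
  have := DFunLike.congr_fun hc f
  rw [AlgHom.comp_apply, hf, map_zero] at this
  exact this.symm

lemma exists_zero [IsAlgClosed k] (s : Finset RR) (hs : s.card < N) (h0 : ∀ f ∈ s, eval 0 f = 0) :
    ∃ p : Fin N → k, p ≠ 0 ∧ ∀ f ∈ s, eval p f = 0 := by
  by_contra hcon
  push Not at hcon
  set I : Ideal RR := Ideal.span (s : Set RR) with hI
  have hz : zeroLocus k I = {0} := by
    rw [hI, zeroLocus_span]
    ext p
    simp only [Set.mem_ofPred_eq, Set.mem_singleton_iff]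
    constructor
    · intro hp
      by_contra hp0
      obtain ⟨f, hf, hf'⟩ := hcon p hp0
      exact hf' (hp f hf)
    · rintro rfl f hf
      exact h0 f hf
  have hr := vanishingIdeal_zeroLocus_eq_radical (k := k) (K := k) I
  rw [hz] at hr
  have hM : vanishingIdeal k ({0} : Set (Fin N → k)) ∈ I.minimalPrimes := by
    refine ⟨⟨inferInstance, hr ▸ Ideal.le_radical⟩, ?_⟩
    rintro P ⟨hP, hIP⟩ -
    rw [hr]
    exact hP.radical_le_iff.2 hIP
  have h1 := Ideal.height_le_card_of_mem_minimalPrimes_span_finset hM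
  have h2 := height_origin (vanishingIdeal k ({0} : Set (Fin N → k))) (fun f hf => by
    rw [mem_vanishingIdeal_singleton_iff]; exact hf)
  have := h2.trans h1
  rw [Nat.cast_le] at this
  omega

lemma eval_zero_homog {f : RR} {d : ℕ} (hf : f.IsHomogeneous d) (hd : d ≠ 0) : eval 0 f = 0 := by
  rw [eval_zero]
  exact hf.coeff_eq_zero (by simpa using hd.symm)

end Zero

section Coord
variable {k : Type} [Field k] {n : ℕ}

/-- coordinates adapted to a point -/
structure IsCoord (φ : MvPolynomial (Fin (n + 1)) k ≃ₐ[k] Polynomial (MvPolynomial (Fin n) k))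
    (p : Fin (n + 1) → k) : Prop where
  coeff : ∀ f d, f.IsHomogeneous d → ∀ i j, i + j = d → ((φ f).coeff i).IsHomogeneous j
  deg : ∀ f d, f.IsHomogeneous d → (φ f).natDegree ≤ d
  lead : ∀ f d, f.IsHomogeneous d → (φ f).coeff d = C (eval p f)
  symmC : ∀ s d, s.IsHomogeneous d → (φ.symm (Polynomial.C s)).IsHomogeneous d
  symmX : (φ.symm Polynomial.X).IsHomogeneous 1

lemma exists_lin_equiv (p : Fin (n + 1) → k) (hp : p ≠ 0) :
    ∃ ψ : MvPolynomial (Fin (n + 1)) k ≃ₐ[k] MvPolynomial (Fin (n + 1)) k,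
      (∀ f d, f.IsHomogeneous d → (ψ f).IsHomogeneous d) ∧
      (∀ f d, f.IsHomogeneous d → (ψ.symm f).IsHomogeneous d) ∧
      ∀ f, eval (Fin.cons 1 0 : Fin (n + 1) → k) (ψ f) = eval p f := by
  obtain ⟨i0, hi0⟩ : ∃ i, p i ≠ 0 := by
    by_contra h
    push Not at h
    exact hp (funext h)
  let τ : Equiv.Perm (Fin (n + 1)) := Equiv.swap 0 i0
  have hτ : ∀ i, τ (τ i) = i := fun i => Equiv.swap_apply_self 0 i0 i
  have hτ0 : τ 0 = i0 := Equiv.swap_apply_left _ _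
  have hτi : τ i0 = 0 := Equiv.swap_apply_right _ _
  let F : Fin (n + 1) → MvPolynomial (Fin (n + 1)) k :=
    fun i => C (p i) * X 0 + if i = i0 then 0 else X (τ i)
  let G : Fin (n + 1) → MvPolynomial (Fin (n + 1)) k :=
    fun j => if j = 0 then C (p i0)⁻¹ * X i0 else X (τ j) - C (p (τ j)) * (C (p i0)⁻¹ * X i0)
  have hFh : ∀ i, (F i).IsHomogeneous 1 := by
    intro i
    refine ((isHomogeneous_X _ _).C_mul _).add ?_
    split_ifs
    · exact isHomogeneous_zero _ _ _
    · exact isHomogeneous_X _ _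
  have hGh : ∀ i, (G i).IsHomogeneous 1 := by
    intro i
    simp only [G]
    split_ifs
    · exact (isHomogeneous_X _ _).C_mul _
    · exact (isHomogeneous_X _ _).sub (((isHomogeneous_X _ _).C_mul _).C_mul _)
  have hpp : (C (p i0) * C (p i0)⁻¹ : MvPolynomial (Fin (n + 1)) k) = 1 := by
    rw [← C_mul, mul_inv_cancel₀ hi0, C_1]
  have hFi : F i0 = C (p i0) * X 0 := by simp [F]
  have hG0 : G 0 = C (p i0)⁻¹ * X i0 := by simp [G]
  have h1 : (aeval F).comp (aeval G) = AlgHom.id k (MvPolynomial (Fin (n + 1)) k) := by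
    apply MvPolynomial.algHom_ext
    intro j
    rw [AlgHom.comp_apply, aeval_X, AlgHom.id_apply]
    by_cases hj : j = 0
    · subst hj
      rw [hG0, map_mul, aeval_X, hFi, ← algebraMap_eq, AlgHom.commutes, algebraMap_eq]
      linear_combination (X 0) * hpp
    · have hne : τ j ≠ i0 := fun h => hj (by rw [← hτ j, h, hτi])
      have : G j = X (τ j) - C (p (τ j)) * (C (p i0)⁻¹ * X i0) := by simp [G, hj]
      rw [this, map_sub, map_mul, map_mul, aeval_X, aeval_X, hFi, ← algebraMap_eq, AlgHom.commutes,
        AlgHom.commutes, algebraMap_eq]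
      have : F (τ j) = C (p (τ j)) * X 0 + X j := by simp [F, hne, hτ]
      rw [this]
      linear_combination (- C (p (τ j)) * X 0) * hpp
  have h2 : (aeval G).comp (aeval F) = AlgHom.id k (MvPolynomial (Fin (n + 1)) k) := by
    apply MvPolynomial.algHom_ext
    intro j
    rw [AlgHom.comp_apply, aeval_X, AlgHom.id_apply]
    by_cases hj : j = i0
    · subst hj
      rw [hFi, map_mul, aeval_X, hG0, ← algebraMap_eq, AlgHom.commutes, algebraMap_eq]
      linear_combination (X j) * hpp
    · have hne : τ j ≠ 0 := fun h => hj (by rw [← hτ j, h, hτ0])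
      have : F j = C (p j) * X 0 + X (τ j) := by simp [F, hj]
      rw [this, map_add, map_mul, aeval_X, aeval_X, hG0, ← algebraMap_eq, AlgHom.commutes,
        algebraMap_eq]
      have : G (τ j) = X j - C (p j) * (C (p i0)⁻¹ * X i0) := by simp [G, hne, hτ]
      rw [this]
      ring
  refine ⟨AlgEquiv.ofAlgHom (aeval F) (aeval G) h1 h2, ?_, ?_, ?_⟩
  · intro f d hf
    have := hf.aeval F hFh
    rwa [one_mul] at this
  · intro f d hf
    have := hf.aeval G hGh
    rwa [one_mul] at this
  · intro f
    have : (aeval (Fin.cons 1 0 : Fin (n + 1) → k)).comp (aeval F) = aeval p := by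
      apply MvPolynomial.algHom_ext
      intro j
      rw [AlgHom.comp_apply, aeval_X, aeval_X]
      by_cases hj : j = i0
      · subst hj
        simp [hFi]
      · have hne : τ j ≠ 0 := fun h => hj (by rw [← hτ j, h, hτ0])
        have : F j = C (p j) * X 0 + X (τ j) := by simp [F, hj]
        rw [this]
        obtain ⟨i, hi⟩ := Fin.exists_succ_eq.2 hne
        rw [← hi]
        simp
    exact DFunLike.congr_fun this f

lemma exists_coord (p : Fin (n + 1) → k) (hp : p ≠ 0) :
    ∃ φ : MvPolynomial (Fin (n + 1)) k ≃ₐ[k] Polynomial (MvPolynomial (Fin n) k), IsCoord φ p := by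
  obtain ⟨ψ, h1, h2, h3⟩ := exists_lin_equiv p hp
  have hdeg : ∀ f d, f.IsHomogeneous d → (ψ.trans (finSuccEquiv k n) f).natDegree ≤ d := by
    intro f d hf
    rw [AlgEquiv.trans_apply, natDegree_finSuccEquiv]
    exact (degreeOf_le_totalDegree _ _).trans (h1 f d hf).totalDegree_le
  have hco : ∀ f d, f.IsHomogeneous d → ∀ i j, i + j = d →
      ((ψ.trans (finSuccEquiv k n) f).coeff i).IsHomogeneous j := by
    intro f d hf i j hij
    exact (h1 f d hf).finSuccEquiv_coeff_isHomogeneous i j hij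
  refine ⟨ψ.trans (finSuccEquiv k n), hco, hdeg, ?_, ?_, ?_⟩
  · intro f d hf
    have e0 := (totalDegree_zero_iff_isHomogeneous _).2 (hco f d hf d 0 rfl)
    rw [totalDegree_eq_zero_iff_eq_C] at e0
    rw [e0]
    congr 1
    rw [← h3, eval_eq_eval_mv_eval', Polynomial.eval_eq_sum_range' (n := d + 1)]
    · rw [Finset.sum_range_succ, Finset.sum_eq_zero]
      · rw [Polynomial.coeff_map, one_pow, mul_one, zero_add]
        conv_rhs => rw [← AlgEquiv.trans_apply, e0]
        rw [eval_C]
      · intro i hi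
        rw [Finset.mem_range] at hi
        rw [Polynomial.coeff_map, one_pow, mul_one, ← AlgEquiv.trans_apply]
        exact eval_zero_homog (hco f d hf i (d - i) (by omega)) (by omega)
    · have := hdeg f d hf
      exact lt_of_le_of_lt Polynomial.natDegree_map_le (Nat.lt_succ_of_le this)
  · intro s d hs
    have : (finSuccEquiv k n).symm (Polynomial.C s) = rename Fin.succ s := by
      rw [AlgEquiv.symm_apply_eq]
      have hc : ((finSuccEquiv k n).toAlgHom.comp (rename Fin.succ)) =
          (Algebra.ofId (MvPolynomial (Fin n) k)
            (Polynomial (MvPolynomial (Fin n) k))).restrictScalars k := by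
        apply MvPolynomial.algHom_ext
        intro i
        simp [finSuccEquiv_X_succ, Algebra.ofId_apply]
      exact (DFunLike.congr_fun hc s).symm
    show (ψ.symm ((finSuccEquiv k n).symm (Polynomial.C s))).IsHomogeneous d
    rw [this]
    exact h2 _ _ hs.rename_isHomogeneous
  · have : (finSuccEquiv k n).symm Polynomial.X = X 0 := by
      rw [AlgEquiv.symm_apply_eq, finSuccEquiv_X_zero]
    show (ψ.symm ((finSuccEquiv k n).symm Polynomial.X)).IsHomogeneous 1
    rw [this]
    exact h2 _ _ (isHomogeneous_X _ _)

variable {φ : MvPolynomial (Fin (n + 1)) k ≃ₐ[k] Polynomial (MvPolynomial (Fin n) k)}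
    {p : Fin (n + 1) → k}

lemma IsCoord.quad (H : IsCoord φ p) {f : MvPolynomial (Fin (n + 1)) k} (hf : f.IsHomogeneous 2)
    (h0 : eval p f = 0) : ∃ l s : MvPolynomial (Fin n) k, l.IsHomogeneous 1 ∧ s.IsHomogeneous 2 ∧
      φ f = Polynomial.C l * Polynomial.X + Polynomial.C s := by
  refine ⟨_, _, H.coeff f 2 hf 1 1 rfl, H.coeff f 2 hf 0 2 rfl, ?_⟩
  conv_lhs => rw [Polynomial.as_sum_range' (φ f) 3 (by have := H.deg f 2 hf; omega)]
  rw [Finset.sum_range_succ, Finset.sum_range_succ, Finset.sum_range_one, H.lead f 2 hf, h0]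
  simp only [← Polynomial.C_mul_X_pow_eq_monomial, map_zero, add_zero, pow_one, pow_zero, mul_one]
  ring

lemma IsCoord.lin (H : IsCoord φ p) {f : MvPolynomial (Fin (n + 1)) k} (hf : f.IsHomogeneous 1) :
    ∃ s : MvPolynomial (Fin n) k, s.IsHomogeneous 1 ∧
      φ f = Polynomial.C (C (eval p f)) * Polynomial.X + Polynomial.C s := by
  refine ⟨_, H.coeff f 1 hf 0 1 rfl, ?_⟩
  conv_lhs => rw [Polynomial.as_sum_range' (φ f) 2 (by have := H.deg f 1 hf; omega)]
  rw [Finset.sum_range_succ, Finset.sum_range_one, H.lead f 1 hf]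
  simp only [← Polynomial.C_mul_X_pow_eq_monomial, pow_one, pow_zero, mul_one]
  ring

end Coord

section Generic
open Polynomial in
lemma generic_prime {S : Type} [CommRing S] [IsDomain S] {Q l1 l2 s1 s2 : S} (hQ : Prime Q)
    (hD : Q ∣ l1 * s2 - l2 * s1) (hl : ¬ Q ∣ l1)
    (hii : ∀ (n : ℕ) (f : S), f * s1 ^ (n + 1) ∈ Ideal.span {Q, l1} →
      f * s2 ^ (n + 1) ∈ Ideal.span {Q, l2} → f ∈ Ideal.span {l1, l2, Q}) :
    (Ideal.span {Polynomial.C Q, Polynomial.C l1 * Polynomial.X + Polynomial.C s1,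
      Polynomial.C l2 * Polynomial.X + Polynomial.C s2}).IsPrime := by
  have hP : (Ideal.span {Q}).IsPrime := (Ideal.span_singleton_prime hQ.ne_zero).2 hQ
  let B := S ⧸ Ideal.span {Q}
  let F := FractionRing B
  let η : S →+* F := (algebraMap B F).comp (Ideal.Quotient.mk _)
  have hη : ∀ a, η a = 0 ↔ Q ∣ a := by
    intro a
    rw [← Ideal.mem_span_singleton, ← Ideal.Quotient.eq_zero_iff_mem]
    simp only [η, RingHom.comp_apply]
    exact IsFractionRing.to_map_eq_zero_iff
  have hl' : η l1 ≠ 0 := fun h => hl ((hη _).1 h)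
  let x : F := - η s1 / η l1
  have hx1 : η l1 * x = - η s1 := mul_div_cancel₀ _ hl'
  have hx2 : η l2 * x = - η s2 := by
    apply mul_left_cancel₀ hl'
    have := (hη _).2 hD
    rw [map_sub, map_mul, map_mul] at this
    linear_combination η l2 * hx1 + this
  let θ : Polynomial S →+* F := Polynomial.eval₂RingHom η x
  have hθ1 : θ (Polynomial.C l1 * Polynomial.X + Polynomial.C s1) = 0 := by
    simp only [θ, coe_eval₂RingHom, Polynomial.eval₂_add, Polynomial.eval₂_mul, Polynomial.eval₂_C, Polynomial.eval₂_X, hx1]; ring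
  have hθ2 : θ (Polynomial.C l2 * Polynomial.X + Polynomial.C s2) = 0 := by
    simp only [θ, coe_eval₂RingHom, Polynomial.eval₂_add, Polynomial.eval₂_mul, Polynomial.eval₂_C, Polynomial.eval₂_X, hx2]; ring
  have hθQ : θ (Polynomial.C Q) = 0 := by
    simp only [θ, coe_eval₂RingHom, Polynomial.eval₂_C]; exact (hη _).2 dvd_rfl
  have key : ∀ (f : Polynomial S) (n : ℕ) (l s : S), f.natDegree ≤ n + 1 → θ f = 0 →
      η l * x = - η s → f.coeff (n + 1) * s ^ (n + 1) ∈ Ideal.span {Q, l} := by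
    intro f n l s hf h0 hls
    have h1 : η l ^ (n + 1) * θ f = 0 := by rw [h0, mul_zero]
    have h2 : η l ^ (n + 1) * θ f =
        η (∑ i ∈ Finset.range (n + 2), f.coeff i * (-s) ^ i * l ^ (n + 1 - i)) := by
      simp only [θ, coe_eval₂RingHom]
      rw [eval₂_eq_sum_range' η (n := n + 2) (by omega), Finset.mul_sum, map_sum]
      refine Finset.sum_congr rfl fun i hi => ?_
      rw [Finset.mem_range] at hi
      rw [map_mul, map_mul, map_pow, map_pow, map_neg, ← hls, mul_pow]
      have : η l ^ (n + 1) = η l ^ i * η l ^ (n + 1 - i) := by rw [← pow_add]; congr 1; omega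
      rw [this]
      ring
    rw [h1, eq_comm, hη, Finset.sum_range_succ] at h2
    have h3 : l ∣ ∑ i ∈ Finset.range (n + 1), f.coeff i * (-s) ^ i * l ^ (n + 1 - i) := by
      refine Finset.dvd_sum fun i hi => ?_
      rw [Finset.mem_range] at hi
      exact Dvd.dvd.mul_left (dvd_pow_self l (by omega)) _
    obtain ⟨u, hu⟩ := h2
    obtain ⟨v, hv⟩ := h3
    rw [Ideal.mem_span_pair]
    refine ⟨(-1) ^ (n + 1) * u, - (-1) ^ (n + 1) * v, ?_⟩
    have h4 : ((-1 : S) ^ (n + 1)) * (-1) ^ (n + 1) = 1 := by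
      rw [← mul_pow]; simp
    rw [hv, neg_pow s, Nat.sub_self, pow_zero, mul_one] at hu
    linear_combination (-(-1 : S) ^ (n + 1)) * hu + f.coeff (n + 1) * s ^ (n + 1) * h4
  have : Ideal.span {Polynomial.C Q, Polynomial.C l1 * Polynomial.X + Polynomial.C s1,
      Polynomial.C l2 * Polynomial.X + Polynomial.C s2} = RingHom.ker θ := by
    apply le_antisymm
    · rw [Ideal.span_le]
      rintro f (rfl | rfl | rfl)
      · exact hθQ
      · exact hθ1
      · exact hθ2
    · have main : ∀ (n : ℕ) (f : Polynomial S), f.natDegree ≤ n → θ f = 0 →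
          f ∈ Ideal.span {Polynomial.C Q, Polynomial.C l1 * Polynomial.X + Polynomial.C s1,
            Polynomial.C l2 * Polynomial.X + Polynomial.C s2} := by
        intro n
        induction n with
        | zero =>
          intro f hf h0
          have hf' := eq_C_of_natDegree_le_zero hf
          rw [hf'] at h0 ⊢
          simp only [θ, coe_eval₂RingHom, Polynomial.eval₂_C] at h0
          obtain ⟨r, hr⟩ := (hη _).1 h0
          rw [hr, map_mul]
          exact Ideal.mul_mem_right _ _ (Ideal.subset_span (by simp))
        | succ n ih =>
          intro f hf h0
          obtain ⟨a, b, c, habc⟩ := mem_span_triple.1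
            (hii n _ (key f n l1 s1 hf h0 hx1) (key f n l2 s2 hf h0 hx2))
          rw [mem_span_triple]
          set g := f - Polynomial.C a * Polynomial.X ^ n *
              (Polynomial.C l1 * Polynomial.X + Polynomial.C s1) -
              Polynomial.C b * Polynomial.X ^ n *
              (Polynomial.C l2 * Polynomial.X + Polynomial.C s2) -
              Polynomial.C c * Polynomial.X ^ (n + 1) * Polynomial.C Q with hg
          have hg0 : θ g = 0 := by
            rw [hg, map_sub, map_sub, map_sub, map_mul θ _ (Polynomial.C l1 * _ + _), hθ1,
              map_mul θ _ (Polynomial.C l2 * _ + _), hθ2, map_mul θ _ (Polynomial.C Q), hθQ, h0]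
            ring
          have hgd : g.natDegree ≤ n + 1 := by
            rw [hg]
            compute_degree
            simpa using hf
          have hgc : g.coeff (n + 1) = 0 := by
            have e : g = f - Polynomial.C (a * l1 + b * l2 + c * Q) * Polynomial.X ^ (n + 1) -
                Polynomial.C (a * s1 + b * s2) * Polynomial.X ^ n := by
              rw [hg]; simp only [map_add, map_mul]; ring
            rw [e, habc]
            rw [Polynomial.coeff_sub, Polynomial.coeff_sub, Polynomial.coeff_C_mul_X_pow,
              Polynomial.coeff_C_mul_X_pow, if_pos rfl, if_neg (by omega)]
            ring
          have hgd' : g.natDegree ≤ n := by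
            rw [natDegree_le_iff_coeff_eq_zero]
            intro m hm
            rcases Nat.eq_or_lt_of_le (Nat.succ_le_of_lt hm) with h | h
            · rw [← h]; exact hgc
            · exact coeff_eq_zero_of_natDegree_lt (lt_of_le_of_lt hgd h)
          obtain ⟨u, v, w, huvw⟩ := mem_span_triple.1 (ih g hgd' hg0)
          refine ⟨u + Polynomial.C c * Polynomial.X ^ (n + 1), v + Polynomial.C a * Polynomial.X ^ n,
            w + Polynomial.C b * Polynomial.X ^ n, ?_⟩
          rw [hg] at huvw
          linear_combination huvw
      intro f hf
      exact main _ f le_rfl hf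
  rw [this]
  exact RingHom.ker_isPrime _
end Generic

section LinForms
variable {k : Type} [Field k] {N : ℕ}

local notation "RR" => MvPolynomial (Fin N) k

lemma homog_cofactor {f l c : RR} {d i j : ℕ} (hf : f.IsHomogeneous d) (hl : l.IsHomogeneous i)
    (h0 : l ≠ 0) (e : f = l * c) (hij : i + j = d) : c.IsHomogeneous j := by
  have h1 := homog_comp_mul (g := c) (e := j) hl
  rw [hij, ← e, homogeneousComponent_of_mem (m := d) (n := d) hf, if_pos rfl, e] at h1
  rw [mul_left_cancel₀ h0 h1]
  exact homogeneousComponent_isHomogeneous _ _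

lemma homog_zero_C {f : RR} (hf : f.IsHomogeneous 0) : ∃ a, f = C a := by
  have := (totalDegree_zero_iff_isHomogeneous _).2 hf
  rw [MvPolynomial.totalDegree_eq_zero_iff_eq_C] at this
  exact ⟨_, this⟩

lemma homog_dvd {f g : RR} {d : ℕ} (hf : f.IsHomogeneous d) (hg : g.IsHomogeneous d) (h : f ∣ g) :
    ∃ a, g = C a * f := by
  obtain ⟨c, e⟩ := h
  by_cases h0 : f = 0
  · exact ⟨0, by rw [e, h0]; ring⟩
  obtain ⟨a, ha⟩ := homog_zero_C (homog_cofactor (j := 0) hg hf h0 e rfl)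
  exact ⟨a, by rw [e, ha]; ring⟩

lemma homog_mem_pair {x y f : RR} {d e : ℕ} (hx : x.IsHomogeneous d) (hy : y.IsHomogeneous d)
    (hf : f.IsHomogeneous (d + e)) (h : f ∈ Ideal.span {x, y}) :
    ∃ a b : RR, a.IsHomogeneous e ∧ b.IsHomogeneous e ∧ f = a * x + b * y := by
  obtain ⟨a, b, h⟩ := Ideal.mem_span_pair.1 h
  refine ⟨homogeneousComponent e a, homogeneousComponent e b, homogeneousComponent_isHomogeneous _ _,
    homogeneousComponent_isHomogeneous _ _, ?_⟩
  have h1 := congrArg (homogeneousComponent (d + e)) h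
  rw [homogeneousComponent_of_mem (m := d + e) (n := d + e) hf, if_pos rfl, map_add, mul_comm a,
    mul_comm b, homog_comp_mul hx, homog_comp_mul hy] at h1
  rw [← h1]
  ring

lemma homog_not_dvd {f g : RR} {d e : ℕ} (hf : f.IsHomogeneous d) (hg : g.IsHomogeneous e)
    (hg0 : g ≠ 0) (h : e < d) : ¬ f ∣ g := by
  rintro ⟨c, rfl⟩
  obtain ⟨i, j, hij, hi, hj⟩ := homog_of_mul hg hg0
  have := hi.inj_right hf (left_ne_zero_of_mul hg0)
  omega

lemma mem_pair_proj {m : RR} {π : RR →ₐ[k] RR} (p1 : π m = 0)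
    (p3 : ∀ r, ∃ r', r = π r + m * r') (g f : RR) :
    f ∈ Ideal.span {m, g} ↔ π g ∣ π f := by
  rw [Ideal.mem_span_pair]
  constructor
  · rintro ⟨a, b, rfl⟩
    rw [map_add, map_mul, map_mul, p1, mul_zero, zero_add]
    exact Dvd.intro_left _ rfl
  · rintro ⟨r, hr⟩
    obtain ⟨f', hf'⟩ := p3 f
    obtain ⟨g', hg'⟩ := p3 g
    exact ⟨f' - g' * r, r, by linear_combination -hf' - hr + r * hg'⟩

/-- linear independence of two polynomials -/
def Ind (x y : RR) : Prop := ∀ a b : k, C a * x + C b * y = 0 → a = 0 ∧ b = 0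

lemma Ind.symm {x y : RR} (h : Ind x y) : Ind y x := fun a b e => (h b a (by rw [← e]; ring)).symm

lemma Ind.left {x y : RR} (h : Ind x y) : x ≠ 0 := by
  intro h0
  have := (h 1 0 (by rw [h0]; simp)).1
  exact one_ne_zero this

lemma Ind.not_dvd {x y : RR} (h : Ind x y) {d : ℕ} (hx : x.IsHomogeneous d) (hy : y.IsHomogeneous d) :
    ¬ x ∣ y := by
  intro hd
  obtain ⟨a, ha⟩ := homog_dvd hx hy hd
  have := (h (-a) 1 (by rw [ha, map_neg, C_1]; ring)).2
  exact one_ne_zero this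

lemma Ind.prime {x y : RR} (h : Ind x y) (hx : x.IsHomogeneous 1) (hy : y.IsHomogeneous 1) :
    (Ideal.span {x, y}).IsPrime := by
  obtain ⟨π, p1, p2, p3, p4⟩ := exists_proj hx h.left
  have hy0 : π y ≠ 0 := by
    intro h0
    obtain ⟨r, hr⟩ := p3 y
    rw [h0, zero_add] at hr
    exact h.not_dvd hx hy ⟨r, hr⟩
  have hp : Prime (π y) := (irr_linear (p4 _ _ hy) hy0).prime
  have : Ideal.span {x, y} = (Ideal.span {π y}).comap π.toRingHom := by
    ext f
    rw [mem_pair_proj p1 p3, Ideal.mem_comap, Ideal.mem_span_singleton]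
    rfl
  rw [this]
  have := (Ideal.span_singleton_prime hp.ne_zero).2 hp
  exact Ideal.comap_isPrime _ _

lemma irr_no_lin {q x : RR} (hq : q.IsHomogeneous 2) (h : Irreducible q) (hx : x.IsHomogeneous 1) :
    ¬ x ∣ q := by
  rintro ⟨r, e⟩
  have hx0 : x ≠ 0 := fun h0 => h.ne_zero (by rw [e, h0, zero_mul])
  have hr := homog_cofactor (j := 1) hq hx hx0 e rfl
  rcases h.isUnit_or_isUnit e with h1 | h1
  · exact homog_not_unit hx (by norm_num) h1
  · exact homog_not_unit hr (by norm_num) h1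

end LinForms

section ClaimA
variable {k : Type} [Field k] {n : ℕ}

local notation "SS" => MvPolynomial (Fin n) k

/-- homogeneous linear forms in `S[X]` of a special shape -/
def Good (x : Polynomial SS) : Prop :=
  (∃ l : SS, l.IsHomogeneous 1 ∧ x = Polynomial.C l) ∨
  (∃ l : SS, l.IsHomogeneous 1 ∧ x = Polynomial.X + Polynomial.C l)

def Concl (I : Ideal (Polynomial SS)) : Prop :=
  I.IsPrime ∨ ∃ x y, Good x ∧ Good y ∧ I ≤ Ideal.span {x, y}

/-- no member of the pencil has a linear factor -/
def NoLin (l1 s1 l2 s2 : SS) : Prop := ∀ a b : k, (a ≠ 0 ∨ b ≠ 0) → ∀ z : SS, z.IsHomogeneous 1 →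
  z ∣ C a * l1 + C b * l2 → z ∣ C a * s1 + C b * s2 → False

lemma span_pair_le {A : Type*} [CommRing A] {f g x y : A} {a b c d : A} (h1 : f = a * x + b * y)
    (h2 : g = c * x + d * y) : Ideal.span {f, g} ≤ Ideal.span {x, y} := by
  rw [Ideal.span_le]
  rintro u (rfl | rfl)
  · exact Ideal.mem_span_pair.2 ⟨_, _, h1.symm⟩
  · exact Ideal.mem_span_pair.2 ⟨_, _, h2.symm⟩

lemma caseDep {l1 s1 s2 : SS} (hl1 : l1.IsHomogeneous 1) (hs1 : s1.IsHomogeneous 2)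
    (hs2 : s2.IsHomogeneous 2) (h0 : l1 ≠ 0) (hno : NoLin l1 s1 0 s2) :
    Concl (Ideal.span {Polynomial.C l1 * Polynomial.X + Polynomial.C s1, Polynomial.C s2}) := by
  have hirr : Irreducible s2 := by
    by_contra hn
    obtain ⟨l, m, hl, hm, e⟩ := not_irr_quad hs2 hn
    exact hno 0 1 (Or.inr one_ne_zero) l hl (by simp) (by rw [e]; simp)
  obtain ⟨π, p1, p2, p3, p4⟩ := exists_proj hl1 h0
  have hs0 : π s2 ≠ 0 := by
    intro h
    obtain ⟨r, hr⟩ := p3 s2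
    rw [h, zero_add] at hr
    exact hno 0 1 (Or.inr one_ne_zero) l1 hl1 (by simp) (by rw [hr]; simp)
  by_cases hrel : IsRelPrime (π s2) (π s1)
  · left
    have hp := generic_prime (Q := s2) (l1 := l1) (s1 := s1) (l2 := 0) (s2 := 0) hirr.prime (by simp)
      (homog_not_dvd hs2 hl1 h0 (by norm_num)) (by
        intro m f h1 _
        rw [Ideal.span_pair_comm, mem_pair_proj p1 p3, map_mul, map_pow] at h1
        classical
        let _ : GCDMonoid SS := UniqueFactorizationMonoid.toGCDMonoid _
        have h2 := (mem_pair_proj p1 p3 s2 f).2 (hrel.pow_right.dvd_of_dvd_mul_right h1)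
        refine Ideal.span_mono ?_ h2
        intro x hx
        simp only [Set.mem_insert_iff, Set.mem_singleton_iff] at hx ⊢
        tauto)
    have e : Ideal.span {Polynomial.C l1 * Polynomial.X + Polynomial.C s1, Polynomial.C s2} =
        Ideal.span {Polynomial.C s2, Polynomial.C l1 * Polynomial.X + Polynomial.C s1,
          Polynomial.C 0 * Polynomial.X + Polynomial.C 0} := by
      ext u
      rw [Ideal.mem_span_pair, mem_span_triple]
      constructor
      · rintro ⟨a, b, rfl⟩
        exact ⟨b, a, 0, by ring⟩
      · rintro ⟨a, b, c, rfl⟩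
        exact ⟨b, a, by simp only [map_zero]; ring⟩
    rw [e]
    exact hp
  · right
    unfold IsRelPrime at hrel
    push Not at hrel
    obtain ⟨d, hd2, hd1, hdu⟩ := hrel
    obtain ⟨e, he⟩ := hd2
    obtain ⟨i, j, hij, hi, hj⟩ := homog_of_mul (he ▸ p4 _ _ hs2) (he ▸ hs0)
    rw [he] at hs0
    have hi0 : i ≠ 0 := fun h => hdu (homog_zero_unit (h ▸ hi) (left_ne_zero_of_mul hs0))
    have : i = 1 ∨ j = 0 := by omega
    rcases this with rfl | rfl
    · obtain ⟨f, hf⟩ := hd1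
      obtain ⟨r1, hr1⟩ := p3 s1
      obtain ⟨r2, hr2⟩ := p3 s2
      refine ⟨Polynomial.C l1, Polynomial.C d, Or.inl ⟨_, hl1, rfl⟩, Or.inl ⟨_, hi, rfl⟩, ?_⟩
      refine span_pair_le (a := Polynomial.X + Polynomial.C r1) (b := Polynomial.C f)
        (c := Polynomial.C r2) (d := Polynomial.C e) ?_ ?_
      · rw [hr1, hf]; simp only [map_add, map_mul]; ring
      · rw [hr2, he]; simp only [map_add, map_mul]; ring
    · exfalso
      have heu : IsUnit e := homog_zero_unit hj (right_ne_zero_of_mul hs0)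
      have hdv : π s2 ∣ π s1 := by
        rw [he]
        exact (heu.mul_right_dvd).2 hd1
      obtain ⟨a, ha⟩ := homog_dvd (p4 _ _ hs2) (p4 _ _ hs1) hdv
      obtain ⟨r1, hr1⟩ := p3 s1
      obtain ⟨r2, hr2⟩ := p3 s2
      refine hno 1 (-a) (Or.inl one_ne_zero) l1 hl1 (by simp) ⟨r1 - C a * r2, ?_⟩
      rw [C_1, map_neg]
      linear_combination hr1 + ha - C a * hr2

lemma caseInd {l1 s1 l2 s2 : SS} (hl1 : l1.IsHomogeneous 1) (hs1 : s1.IsHomogeneous 2)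
    (hl2 : l2.IsHomogeneous 1) (hs2 : s2.IsHomogeneous 2) (hind : Ind l1 l2)
    (hno : NoLin l1 s1 l2 s2) :
    Concl (Ideal.span {Polynomial.C l1 * Polynomial.X + Polynomial.C s1,
      Polynomial.C l2 * Polynomial.X + Polynomial.C s2}) := by
  have hP := hind.prime hl1 hl2
  have hp1 : Prime l1 := (irr_linear hl1 hind.left).prime
  have hnd := hind.not_dvd hl1 hl2
  set D := l1 * s2 - l2 * s1 with hD
  have hDh : D.IsHomogeneous 3 := (hl1.mul hs2).sub (hl2.mul hs1)
  have hD0 : D ≠ 0 := by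
    intro h0
    have : l1 ∣ l2 * s1 := ⟨s2, by linear_combination hD - h0⟩
    have h1 := (hp1.dvd_or_dvd this).resolve_left hnd
    exact hno 1 0 (Or.inl one_ne_zero) l1 hl1 (by simp) (by simpa using h1)
  by_cases hirr : Irreducible D
  · by_cases hs : s1 ∈ Ideal.span {l1, l2} ∧ s2 ∈ Ideal.span {l1, l2}
    · right
      obtain ⟨a, b, h1⟩ := Ideal.mem_span_pair.1 hs.1
      obtain ⟨c, d, h2⟩ := Ideal.mem_span_pair.1 hs.2
      refine ⟨Polynomial.C l1, Polynomial.C l2, Or.inl ⟨_, hl1, rfl⟩, Or.inl ⟨_, hl2, rfl⟩, ?_⟩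
      refine span_pair_le (a := Polynomial.X + Polynomial.C a) (b := Polynomial.C b)
        (c := Polynomial.C c) (d := Polynomial.X + Polynomial.C d) ?_ ?_
      · rw [← h1]; simp only [map_add, map_mul]; ring
      · rw [← h2]; simp only [map_add, map_mul]; ring
    · left
      have hDP : D ∈ Ideal.span {l1, l2} :=
        Ideal.mem_span_pair.2 ⟨s2, -s1, by rw [hD]; ring⟩
      have hl1P : l1 ∈ Ideal.span {l1, l2} := Ideal.subset_span (by simp)
      have hl2P : l2 ∈ Ideal.span {l1, l2} := Ideal.subset_span (by simp)
      have hle1 : Ideal.span {D, l1} ≤ Ideal.span {l1, l2} := by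
        rw [Ideal.span_le]; rintro u (rfl | rfl) <;> assumption
      have hle2 : Ideal.span {D, l2} ≤ Ideal.span {l1, l2} := by
        rw [Ideal.span_le]; rintro u (rfl | rfl) <;> assumption
      have hp := generic_prime (Q := D) (l1 := l1) (s1 := s1) (l2 := l2) (s2 := s2) hirr.prime dvd_rfl
        (homog_not_dvd hDh hl1 hind.left (by norm_num)) (by
          intro m f h1 h2
          have hf : f ∈ Ideal.span {l1, l2} := by
            by_contra hf
            refine hs ⟨?_, ?_⟩
            · exact hP.mem_of_pow_mem _ ((hP.mem_or_mem (hle1 h1)).resolve_left hf)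
            · exact hP.mem_of_pow_mem _ ((hP.mem_or_mem (hle2 h2)).resolve_left hf)
          refine Ideal.span_mono ?_ hf
          intro x hx
          simp only [Set.mem_insert_iff, Set.mem_singleton_iff] at hx ⊢
          tauto)
      have e : Ideal.span {Polynomial.C l1 * Polynomial.X + Polynomial.C s1,
            Polynomial.C l2 * Polynomial.X + Polynomial.C s2} =
          Ideal.span {Polynomial.C D, Polynomial.C l1 * Polynomial.X + Polynomial.C s1,
            Polynomial.C l2 * Polynomial.X + Polynomial.C s2} := by
        ext u
        rw [Ideal.mem_span_pair, mem_span_triple]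
        constructor
        · rintro ⟨a, b, rfl⟩
          exact ⟨0, a, b, by ring⟩
        · rintro ⟨a, b, c, rfl⟩
          refine ⟨b - a * Polynomial.C l2, c + a * Polynomial.C l1, ?_⟩
          rw [hD]
          simp only [map_sub, map_mul]
          ring
      rw [e]
      exact hp
  · obtain ⟨m, Q, hm, hQ, e⟩ := not_irr_cubic hDh hirr hD0
    have hm0 : m ≠ 0 := fun h => hD0 (by rw [e, h, zero_mul])
    have hmp : Prime m := (irr_linear hm hm0).prime
    by_cases hmP : m ∈ Ideal.span {l1, l2}
    · exfalso
      obtain ⟨a, b, ha, hb, hab⟩ := homog_mem_pair (e := 0) hl1 hl2 hm hmP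
      obtain ⟨α, rfl⟩ := homog_zero_C ha
      obtain ⟨β, rfl⟩ := homog_zero_C hb
      by_cases hα : α = 0
      · have hβ : β ≠ 0 := by
          rintro rfl
          exact hm0 (by rw [hab, hα]; simp)
        refine hno α β (Or.inr hβ) m hm (by rw [← hab]) ?_
        have h1 : m ∣ l1 * (C α * s1 + C β * s2) :=
          ⟨s1 + C β * Q, by linear_combination (-s1) * hab + C β * e - C β * hD⟩
        refine (hmp.dvd_or_dvd h1).resolve_left fun h2 => ?_
        obtain ⟨c, hc⟩ := homog_dvd hm hl1 h2
        have := hind (c * α - 1) (c * β) (by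
          rw [C_sub, C_mul, C_mul, C_1]; linear_combination (-C c) * hab - hc)
        rw [hα] at this
        simp at this
      · refine hno α β (Or.inl hα) m hm (by rw [← hab]) ?_
        have h1 : m ∣ l2 * (C α * s1 + C β * s2) :=
          ⟨s2 - C α * Q, by linear_combination (-s2) * hab - C α * e + C α * hD⟩
        refine (hmp.dvd_or_dvd h1).resolve_left fun h2 => ?_
        obtain ⟨c, hc⟩ := homog_dvd hm hl2 h2
        have := hind (c * α) (c * β - 1) (by
          rw [C_sub, C_mul, C_mul, C_1]; linear_combination (-C c) * hab - hc)
        have h3 : c = 0 := (mul_eq_zero.1 this.1).resolve_right hα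
        rw [h3] at this
        simp at this
    · right
      have hQP : Q ∈ Ideal.span {l1, l2} := by
        refine (hP.mem_or_mem (x := m) (y := Q) ?_).resolve_left hmP
        rw [← e]
        exact Ideal.mem_span_pair.2 ⟨s2, -s1, by rw [hD]; ring⟩
      obtain ⟨A, B, hA, hB, hAB⟩ := homog_mem_pair (e := 1) hl1 hl2 hQ hQP
      have h1 : l1 * (s2 - m * A) = l2 * (s1 + m * B) := by
        linear_combination hD * (-1) + e + m * hAB
      obtain ⟨c, hc⟩ := (hp1.dvd_or_dvd (Dvd.intro _ h1)).resolve_left hnd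
      have hch : c.IsHomogeneous 1 :=
        homog_cofactor (hs1.add (hm.mul hB)) hl1 hind.left hc rfl
      have hc2 : s2 - m * A = l2 * c := by
        apply mul_left_cancel₀ hind.left
        rw [h1, hc]; ring
      refine ⟨Polynomial.X + Polynomial.C c, Polynomial.C m, Or.inr ⟨_, hch, rfl⟩,
        Or.inl ⟨_, hm, rfl⟩, ?_⟩
      have e1 : s1 = l1 * c - m * B := by rw [← hc]; ring
      have e2 : s2 = l2 * c + m * A := by rw [← hc2]; ring
      refine span_pair_le (a := Polynomial.C l1) (b := - Polynomial.C B)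
        (c := Polynomial.C l2) (d := Polynomial.C A) ?_ ?_
      · rw [e1]; simp only [map_sub, map_mul]; ring
      · rw [e2]; simp only [map_add, map_mul]; ring

end ClaimA

section Driver
variable {k : Type} [Field k]

lemma small_dvd {n : ℕ} (hn : n ≤ 1) : ∃ z : MvPolynomial (Fin n) k, z.IsHomogeneous 1 ∧
    ∀ f d, f.IsHomogeneous d → d ≠ 0 → z ∣ f := by
  interval_cases n
  · refine ⟨0, isHomogeneous_zero _ _ _, fun f d hf hd => ?_⟩
    rw [zero_dvd_iff]
    obtain ⟨a, ha⟩ : ∃ a, f = C a := ⟨_, MvPolynomial.eq_C_of_isEmpty f⟩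
    have := eval_zero_homog hf hd
    rw [ha, eval_C] at this
    rw [ha, this, C_0]
  · refine ⟨X 0, isHomogeneous_X _ _, fun f d hf hd => ?_⟩
    obtain ⟨π, p1, p2, p3, p4⟩ := exists_proj (isHomogeneous_X k (0 : Fin 1)) (X_ne_zero _)
    have : π = (Algebra.ofId k (MvPolynomial (Fin 1) k)).comp (aeval (0 : Fin 1 → k)) := by
      apply MvPolynomial.algHom_ext
      intro i
      rw [Subsingleton.elim i 0, p1]
      simp
    obtain ⟨r, hr⟩ := p3 f
    refine ⟨r, ?_⟩
    have h0 : π f = 0 := by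
      rw [this, AlgHom.comp_apply]
      have := eval_zero_homog hf hd
      rw [← coe_aeval_eq_eval] at this
      have h2 : aeval (0 : Fin 1 → k) f = 0 := this
      rw [h2, map_zero]
    rw [h0, zero_add] at hr
    exact hr

variable {n : ℕ} {φ : MvPolynomial (Fin (n + 1)) k ≃ₐ[k] Polynomial (MvPolynomial (Fin n) k)}
  {p : Fin (n + 1) → k}

lemma coord_C (a : k) : φ (C a) = Polynomial.C (C a) := by
  rw [← algebraMap_eq, AlgEquiv.commutes]
  rfl

lemma IsCoord.no_dvd (H : IsCoord φ p) {q : MvPolynomial (Fin (n + 1)) k} (hq : q.IsHomogeneous 2)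
    (h : Irreducible q) {l s z : MvPolynomial (Fin n) k}
    (e : φ q = Polynomial.C l * Polynomial.X + Polynomial.C s) (hz : z.IsHomogeneous 1)
    (h1 : z ∣ l) (h2 : z ∣ s) : False := by
  apply irr_no_lin hq h (H.symmC z 1 hz)
  obtain ⟨a, rfl⟩ := h1
  obtain ⟨b, rfl⟩ := h2
  refine ⟨φ.symm (Polynomial.C a * Polynomial.X + Polynomial.C b), ?_⟩
  rw [← map_mul, ← φ.symm_apply_apply q, e]
  congr 1
  simp only [map_mul]
  ring

lemma IsCoord.noLin (H : IsCoord φ p) {q1 q2 : MvPolynomial (Fin (n + 1)) k}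
    (h1 : q1.IsHomogeneous 2) (h2 : q2.IsHomogeneous 2) (h : AllIrr q1 q2)
    {l1 s1 l2 s2 : MvPolynomial (Fin n) k}
    (e1 : φ q1 = Polynomial.C l1 * Polynomial.X + Polynomial.C s1)
    (e2 : φ q2 = Polynomial.C l2 * Polynomial.X + Polynomial.C s2) : NoLin l1 s1 l2 s2 := by
  intro a b hab z hz hl hs
  refine H.no_dvd (pencil_homog h1 h2 a b) (h a b hab) (l := C a * l1 + C b * l2)
    (s := C a * s1 + C b * s2) ?_ hz hl hs
  rw [map_add, map_mul, map_mul, coord_C, coord_C, e1, e2]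
  simp only [map_mul, map_add]
  ring

lemma IsCoord.good (H : IsCoord φ p) {x} (hx : Good x) : (φ.symm x).IsHomogeneous 1 := by
  rcases hx with ⟨l, hl, rfl⟩ | ⟨l, hl, rfl⟩
  · exact H.symmC _ _ hl
  · rw [map_add]
    exact H.symmX.add (H.symmC _ _ hl)

lemma coord_span (x y : MvPolynomial (Fin (n + 1)) k) :
    Ideal.span {x, y} = (Ideal.span {φ x, φ y}).comap φ.toRingEquiv.toRingHom := by
  ext f
  rw [Ideal.mem_comap, Ideal.mem_span_pair, Ideal.mem_span_pair]
  constructor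
  · rintro ⟨a, b, rfl⟩
    exact ⟨φ a, φ b, by rw [← map_mul, ← map_mul, ← map_add]; rfl⟩
  · rintro ⟨a, b, h⟩
    refine ⟨φ.symm a, φ.symm b, φ.injective ?_⟩
    simp only [map_add, map_mul, AlgEquiv.apply_symm_apply]
    exact h

def ConclA {N : ℕ} (q1 q2 : MvPolynomial (Fin N) k) : Prop :=
  (Ideal.span {q1, q2}).IsPrime ∨ ∃ x y : MvPolynomial (Fin N) k, x.IsHomogeneous 1 ∧
    y.IsHomogeneous 1 ∧ q1 ∈ Ideal.span {x, y} ∧ q2 ∈ Ideal.span {x, y}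

lemma IsCoord.concl (H : IsCoord φ p) {q1 q2 : MvPolynomial (Fin (n + 1)) k}
    (h : Concl (Ideal.span {φ q1, φ q2})) : ConclA q1 q2 := by
  rcases h with h | ⟨x, y, hx, hy, h⟩
  · left
    rw [coord_span (φ := φ)]
    exact Ideal.comap_isPrime _ _
  · right
    refine ⟨_, _, H.good hx, H.good hy, ?_, ?_⟩
    · rw [coord_span (φ := φ), Ideal.mem_comap, AlgEquiv.apply_symm_apply, AlgEquiv.apply_symm_apply]
      exact h (Ideal.subset_span (by left; rfl))
    · rw [coord_span (φ := φ), Ideal.mem_comap, AlgEquiv.apply_symm_apply, AlgEquiv.apply_symm_apply]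
      exact h (Ideal.subset_span (by right; rfl))

lemma caseDep' {l1 s1 l2 s2 : MvPolynomial (Fin n) k} (hl1 : l1.IsHomogeneous 1)
    (hs1 : s1.IsHomogeneous 2) (hs2 : s2.IsHomogeneous 2) (h0 : l1 ≠ 0)
    (hno : NoLin l1 s1 l2 s2) (a : k) (ha : l2 = C a * l1) :
    Concl (Ideal.span {Polynomial.C l1 * Polynomial.X + Polynomial.C s1,
      Polynomial.C l2 * Polynomial.X + Polynomial.C s2}) := by
  have := caseDep (s2 := s2 - C a * s1) hl1 hs1 (hs2.sub (hs1.C_mul a)) h0 (by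
    intro u v huv z hz h1 h2
    refine hno (u - v * a) v ?_ z hz ?_ ?_
    · by_contra hn
      push Not at hn
      obtain ⟨h3, h4⟩ := hn
      rw [h4] at h3
      simp at h3
      rcases huv with h | h
      · exact h h3
      · exact h h4
    · convert h1 using 1
      rw [ha, C_sub, C_mul]; ring
    · convert h2 using 1
      rw [C_sub, C_mul]; ring)
  convert this using 1
  apply le_antisymm
  · refine span_pair_le (a := 1) (b := 0) (c := Polynomial.C (C a)) (d := 1) (by ring) ?_
    rw [ha]; simp only [map_mul, map_sub]; ring
  · refine span_pair_le (a := 1) (b := 0) (c := -Polynomial.C (C a)) (d := 1) (by ring) ?_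
    rw [ha]; simp only [map_mul, map_sub]; ring

theorem claimA [IsAlgClosed k] : ∀ (N : ℕ) (q1 q2 : MvPolynomial (Fin N) k), q1.IsHomogeneous 2 →
    q2.IsHomogeneous 2 → AllIrr q1 q2 → ConclA q1 q2 := by
  intro N
  induction N with
  | zero =>
    intro q1 q2 h1 h2 h
    exfalso
    obtain ⟨z, hz, hz2⟩ := small_dvd (k := k) (n := 0) (by norm_num)
    have := h 1 0 (Or.inl one_ne_zero)
    exact irr_no_lin (pencil_homog h1 h2 1 0) this hz (hz2 _ _ (pencil_homog h1 h2 1 0) (by norm_num))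
  | succ n IH =>
    intro q1 q2 h1 h2 h
    by_cases hn : n ≤ 1
    · exfalso
      obtain ⟨z, hz, hz2⟩ := small_dvd (k := k) hn
      have hp : (fun _ => 1 : Fin (n + 1) → k) ≠ 0 := fun h => one_ne_zero (congrFun h 0)
      obtain ⟨φ, H⟩ := exists_coord _ hp
      set p := (fun _ => 1 : Fin (n + 1) → k)
      obtain ⟨a, b, hab, hv⟩ : ∃ a b : k, (a ≠ 0 ∨ b ≠ 0) ∧ eval p (C a * q1 + C b * q2) = 0 := by
        by_cases h0 : eval p q1 = 0
        · exact ⟨1, 0, Or.inl one_ne_zero, by simp [h0]⟩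
        · exact ⟨eval p q2, - eval p q1, Or.inr (neg_ne_zero.2 h0), by simp; ring⟩
      obtain ⟨l, s, hl, hs, e⟩ := H.quad (pencil_homog h1 h2 a b) hv
      exact H.no_dvd (pencil_homog h1 h2 a b) (h a b hab) e hz (hz2 _ _ hl (by norm_num))
        (hz2 _ _ hs (by norm_num))
    · classical
      obtain ⟨p, hp, hp2⟩ := exists_zero (k := k) (N := n + 1) {q1, q2}
        (lt_of_le_of_lt Finset.card_le_two (by omega)) (by
          intro f hf
          simp only [Finset.mem_insert, Finset.mem_singleton] at hf
          rcases hf with rfl | rfl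
          · exact eval_zero_homog h1 (by norm_num)
          · exact eval_zero_homog h2 (by norm_num))
      obtain ⟨φ, H⟩ := exists_coord _ hp
      obtain ⟨l1, s1, hl1, hs1, e1⟩ := H.quad h1 (hp2 _ (by simp))
      obtain ⟨l2, s2, hl2, hs2, e2⟩ := H.quad h2 (hp2 _ (by simp))
      have hno := H.noLin h1 h2 h e1 e2
      apply H.concl
      rw [e1, e2]
      by_cases hz1 : l1 = 0
      · by_cases hz2 : l2 = 0
        · subst hz1 hz2
          have hA : AllIrr s1 s2 := by
            intro a b hab
            by_contra hirr
            obtain ⟨l, m, hl, hm, e⟩ := not_irr_quad (pencil_homog hs1 hs2 a b) hirr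
            exact hno a b hab l hl (by simp) ⟨_, e⟩
          simp only [map_zero, zero_mul, zero_add]
          rcases IH s1 s2 hs1 hs2 hA with hpr | ⟨x, y, hx, hy, hx1, hx2⟩
          · left
            have := Ideal.isPrime_map_C_of_isPrime (P := Ideal.span {s1, s2})
            rwa [Ideal.map_span, Set.image_pair] at this
          · right
            refine ⟨_, _, Or.inl ⟨x, hx, rfl⟩, Or.inl ⟨y, hy, rfl⟩, ?_⟩
            obtain ⟨a, b, hab⟩ := Ideal.mem_span_pair.1 hx1
            obtain ⟨c, d, hcd⟩ := Ideal.mem_span_pair.1 hx2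
            refine span_pair_le (a := Polynomial.C a) (b := Polynomial.C b)
              (c := Polynomial.C c) (d := Polynomial.C d) ?_ ?_
            · rw [← hab]; simp
            · rw [← hcd]; simp
        · rw [Ideal.span_pair_comm]
          refine caseDep' hl2 hs2 hs1 hz2 ?_ 0 (by rw [hz1]; simp)
          intro a b hab z hz u v
          exact hno b a hab.symm z hz (by rwa [add_comm]) (by rwa [add_comm])
      · by_cases hi : l1 ∣ l2
        · obtain ⟨a, ha⟩ := homog_dvd hl1 hl2 hi
          exact caseDep' hl1 hs1 hs2 hz1 hno a ha
        · refine caseInd hl1 hs1 hl2 hs2 ?_ hno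
          intro a b hab
          have hb : b = 0 := by
            by_contra hb
            apply hi
            refine ⟨- C (b⁻¹ * a), ?_⟩
            have : (C b⁻¹ * C b : MvPolynomial (Fin n) k) = 1 := by
              rw [← C_mul, inv_mul_cancel₀ hb, C_1]
            rw [C_mul]
            linear_combination C b⁻¹ * hab - l2 * this
          refine ⟨?_, hb⟩
          rw [hb] at hab
          simpa [hz1] using hab

end Driver

section DetPrime
variable {k : Type} [Field k]

lemma exists_eig [IsAlgClosed k] (α β γ δ : k) : ∃ t b c : k, (b ≠ 0 ∨ c ≠ 0) ∧
    b * α + c * γ = t * b ∧ b * β + c * δ = t * c := by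
  by_cases hγ : γ = 0
  · exact ⟨δ, 0, 1, Or.inr one_ne_zero, by rw [hγ]; ring, by ring⟩
  · have hd : ((Polynomial.X - Polynomial.C α) * (Polynomial.X - Polynomial.C δ) -
        Polynomial.C (β * γ) : Polynomial k).degree = 2 := by
      have e : ((Polynomial.X - Polynomial.C α) * (Polynomial.X - Polynomial.C δ) -
        Polynomial.C (β * γ) : Polynomial k) = Polynomial.C 1 * Polynomial.X ^ 2 +
          Polynomial.C (-α - δ) * Polynomial.X + Polynomial.C (α * δ - β * γ) := by
        simp only [map_sub, map_neg, map_mul, map_one]; ring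
      rw [e]
      exact Polynomial.degree_quadratic one_ne_zero
    obtain ⟨t, ht⟩ := IsAlgClosed.exists_root _ (by rw [hd]; norm_num)
    simp [Polynomial.IsRoot] at ht
    exact ⟨t, γ, t - α, Or.inl hγ, by ring, by linear_combination -ht⟩

section S
variable {n : ℕ}
local notation "SS" => MvPolynomial (Fin n) k

lemma detCore [IsAlgClosed k] {σ X2 X3 l1 l2 l3 : SS} (hX2 : X2.IsHomogeneous 1)
    (hX3 : X3.IsHomogeneous 1) (hl1 : l1.IsHomogeneous 1) (hl2 : l2.IsHomogeneous 1)
    (hl3 : l3.IsHomogeneous 1)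
    (h1 : ∀ a b c : k, C a * l1 + C b * l2 + C c * l3 = 0 → a = 0 ∧ b = 0 ∧ c = 0)
    (h2 : ∀ b c u v : k, (b ≠ 0 ∨ c ≠ 0) → (u ≠ 0 ∨ v ≠ 0) →
      C u * (C b * X2 + C c * X3) + C v * (C b * l2 + C c * l3) = 0 → False) :
    (Ideal.span {Polynomial.C (X2 * l3 - X3 * l2),
      Polynomial.C l2 * Polynomial.X + Polynomial.C (σ * l2 - l1 * X2),
      Polynomial.C l3 * Polynomial.X + Polynomial.C (σ * l3 - l1 * X3)}).IsPrime := by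
  have hind : Ind l2 l3 := fun b c e => (h1 0 b c (by rw [← e]; simp)).2
  have hQh : (X2 * l3 - X3 * l2).IsHomogeneous 2 := (hX2.mul hl3).sub (hX3.mul hl2)
  have hP := hind.prime hl2 hl3
  have hl1P : l1 ∉ Ideal.span {l2, l3} := by
    intro h
    obtain ⟨a, b, ha, hb, e⟩ := homog_mem_pair (e := 0) hl2 hl3 hl1 h
    obtain ⟨a, rfl⟩ := homog_zero_C ha
    obtain ⟨b, rfl⟩ := homog_zero_C hb
    have := (h1 (-1) a b (by rw [e]; simp only [map_neg, map_one]; ring)).1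
    simp at this
  have key : ∀ b c : k, (b ≠ 0 ∨ c ≠ 0) → (C b * l2 + C c * l3) ∣ X2 * l3 - X3 * l2 → False := by
    intro b c hbc hd
    set l := C b * l2 + C c * l3 with hl
    have hlh : l.IsHomogeneous 1 := (hl2.C_mul b).add (hl3.C_mul c)
    have hl0 : l ≠ 0 := by
      intro h
      have := hind b c h
      tauto
    have hlp : Prime l := (irr_linear hlh hl0).prime
    have hcase : l ∣ C b * X2 + C c * X3 := by
      by_cases hb : b = 0
      · have hc : c ≠ 0 := by tauto
        have h3 : l ∣ l2 * (C b * X2 + C c * X3) := by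
          have : l2 * (C b * X2 + C c * X3) = l * X2 - C c * (X2 * l3 - X3 * l2) := by
            rw [hl]; ring
          rw [this]
          exact dvd_sub (Dvd.intro _ rfl) (hd.mul_left _)
        refine (hlp.dvd_or_dvd h3).resolve_left fun h4 => ?_
        obtain ⟨t, ht⟩ := homog_dvd hlh hl2 h4
        have := hind (1 - t * b) (-(t * c)) (by
          rw [hl] at ht
          simp only [map_sub, map_neg, map_mul, map_one]; linear_combination ht)
        have h5 : t = 0 := (mul_eq_zero.1 (neg_eq_zero.1 this.2)).resolve_right hc
        rw [h5] at this
        simp at this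
      · have h3 : l ∣ l3 * (C b * X2 + C c * X3) := by
          have : l3 * (C b * X2 + C c * X3) = l * X3 + C b * (X2 * l3 - X3 * l2) := by
            rw [hl]; ring
          rw [this]
          exact dvd_add (Dvd.intro _ rfl) (hd.mul_left _)
        refine (hlp.dvd_or_dvd h3).resolve_left fun h4 => ?_
        obtain ⟨t, ht⟩ := homog_dvd hlh hl3 h4
        have := hind (-(t * b)) (1 - t * c) (by
          rw [hl] at ht
          simp only [map_sub, map_neg, map_mul, map_one]; linear_combination ht)
        have h5 : t = 0 := (mul_eq_zero.1 (neg_eq_zero.1 this.1)).resolve_right hb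
        rw [h5] at this
        simp at this
    obtain ⟨t, ht⟩ := homog_dvd hlh ((hX2.C_mul b).add (hX3.C_mul c)) hcase
    exact h2 b c 1 (-t) hbc (Or.inl one_ne_zero) (by
      rw [ht, hl]; simp only [map_neg, map_one]; ring)
  have hQP : X2 * l3 - X3 * l2 ∈ Ideal.span {l2, l3} :=
    Ideal.mem_span_pair.2 ⟨-X3, X2, by ring⟩
  have hmem : ∀ m : SS, m.IsHomogeneous 1 → m ∈ Ideal.span {l2, l3} → m ∣ X2 * l3 - X3 * l2 →
      False := by
    intro m hm hmP hd
    by_cases hm0 : m = 0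
    · rw [hm0, zero_dvd_iff] at hd
      exact key 1 0 (Or.inl one_ne_zero) (by rw [hd]; exact dvd_zero _)
    obtain ⟨a, b, ha, hb, e⟩ := homog_mem_pair (e := 0) hl2 hl3 hm hmP
    obtain ⟨a, rfl⟩ := homog_zero_C ha
    obtain ⟨b, rfl⟩ := homog_zero_C hb
    refine key a b ?_ (by rw [← e]; exact hd)
    by_contra hn
    push Not at hn
    exact hm0 (by rw [e, hn.1, hn.2]; simp)
  have hirr : Irreducible (X2 * l3 - X3 * l2) := by
    by_contra hn
    obtain ⟨l, m, hl, hm, e⟩ := not_irr_quad hQh hn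
    rcases hP.mem_or_mem (x := l) (y := m) (by rw [← e]; exact hQP) with h | h
    · exact hmem l hl h ⟨_, e⟩
    · exact hmem m hm h ⟨l, by rw [e]; ring⟩
  have hX : X2 ∉ Ideal.span {l2, l3} ∨ X3 ∉ Ideal.span {l2, l3} := by
    by_contra hn
    push Not at hn
    obtain ⟨a, b, ha, hb, e⟩ := homog_mem_pair (e := 0) hl2 hl3 hX2 hn.1
    obtain ⟨a, rfl⟩ := homog_zero_C ha
    obtain ⟨b, rfl⟩ := homog_zero_C hb
    obtain ⟨c, d, hc, hd, e'⟩ := homog_mem_pair (e := 0) hl2 hl3 hX3 hn.2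
    obtain ⟨c, rfl⟩ := homog_zero_C hc
    obtain ⟨d, rfl⟩ := homog_zero_C hd
    obtain ⟨t, u, v, huv, f1, f2⟩ := exists_eig a b c d
    apply h2 u v 1 (-t) huv (Or.inl one_ne_zero)
    have g1 := congrArg (C : k → SS) f1
    have g2 := congrArg (C : k → SS) f2
    simp only [map_add, map_mul] at g1 g2
    rw [e, e']
    simp only [map_neg, map_one]
    linear_combination l2 * g1 + l3 * g2
  refine generic_prime hirr.prime ⟨l1, by ring⟩ (homog_not_dvd hQh hl2 hind.left (by norm_num)) ?_
  intro m f hf1 hf2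
  have hle : Ideal.span {l2, l3} ≤ Ideal.span {l2, l3, X2 * l3 - X3 * l2} :=
    Ideal.span_mono (by intro x hx; simp at hx ⊢; tauto)
  apply hle
  rcases hX with hX | hX
  · have h3 : f * (σ * l2 - l1 * X2) ^ (m + 1) ∈ Ideal.span {l2, l3} := by
      refine (?_ : Ideal.span {X2 * l3 - X3 * l2, l2} ≤ _) hf1
      exact span_pair_le (a := -X3) (b := X2) (c := 1) (d := 0) (by ring) (by ring)
    refine (hP.mem_or_mem h3).resolve_right fun h4 => ?_
    have h5 := hP.mem_of_pow_mem _ h4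
    have h6 : l1 * X2 ∈ Ideal.span {l2, l3} := by
      have : l1 * X2 = σ * l2 - (σ * l2 - l1 * X2) := by ring
      rw [this]
      exact Ideal.sub_mem _ (Ideal.mul_mem_left _ _ (Ideal.subset_span (by simp))) h5
    rcases hP.mem_or_mem h6 with h | h
    · exact hl1P h
    · exact hX h
  · have h3 : f * (σ * l3 - l1 * X3) ^ (m + 1) ∈ Ideal.span {l2, l3} := by
      refine (?_ : Ideal.span {X2 * l3 - X3 * l2, l3} ≤ _) hf2
      exact span_pair_le (a := -X3) (b := X2) (c := 0) (d := 1) (by ring) (by ring)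
    refine (hP.mem_or_mem h3).resolve_right fun h4 => ?_
    have h5 := hP.mem_of_pow_mem _ h4
    have h6 : l1 * X3 ∈ Ideal.span {l2, l3} := by
      have : l1 * X3 = σ * l3 - (σ * l3 - l1 * X3) := by ring
      rw [this]
      exact Ideal.sub_mem _ (Ideal.mul_mem_left _ _ (Ideal.subset_span (by simp))) h5
    rcases hP.mem_or_mem h6 with h | h
    · exact hl1P h
    · exact hX h
end S
end DetPrime

section DetPrime2
variable {k : Type} [Field k]

/-- 1-generic 3 x 2 matrices of linear forms -/
structure Gen3 {N : ℕ} (X1 X2 X3 l1 l2 l3 : MvPolynomial (Fin N) k) : Prop where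
  x1 : X1.IsHomogeneous 1
  x2 : X2.IsHomogeneous 1
  x3 : X3.IsHomogeneous 1
  y1 : l1.IsHomogeneous 1
  y2 : l2.IsHomogeneous 1
  y3 : l3.IsHomogeneous 1
  gen : ∀ a b c : k, (a ≠ 0 ∨ b ≠ 0 ∨ c ≠ 0) → ∀ u v : k, (u ≠ 0 ∨ v ≠ 0) →
    C u * (C a * X1 + C b * X2 + C c * X3) + C v * (C a * l1 + C b * l2 + C c * l3) = 0 →
    False

def Mins {N : ℕ} (X1 X2 X3 l1 l2 l3 : MvPolynomial (Fin N) k) : Ideal (MvPolynomial (Fin N) k) :=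
  Ideal.span {X2 * l3 - X3 * l2, X1 * l2 - X2 * l1, X1 * l3 - X3 * l1}

lemma span_triple_le {A : Type*} [CommRing A] {f g h x y z : A} {a b c d e i j l m : A}
    (h1 : f = a * x + b * y + c * z)
    (h2 : g = d * x + e * y + i * z) (h3 : h = j * x + l * y + m * z) :
    Ideal.span {f, g, h} ≤ Ideal.span {x, y, z} := by
  rw [Ideal.span_le]
  rintro u (rfl | rfl | rfl)
  · exact mem_span_triple.2 ⟨_, _, _, h1.symm⟩
  · exact mem_span_triple.2 ⟨_, _, _, h2.symm⟩
  · exact mem_span_triple.2 ⟨_, _, _, h3.symm⟩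

lemma detPrime0 [IsAlgClosed k] {n : ℕ} {X1 X2 X3 l1 l2 l3 : MvPolynomial (Fin (n + 1)) k}
    (G : Gen3 X1 X2 X3 l1 l2 l3) {p : Fin (n + 1) → k} (hp : p ≠ 0)
    (e1 : eval p X1 = 1) (e2 : eval p X2 = 0) (e3 : eval p X3 = 0)
    (f1 : eval p l1 = 0) (f2 : eval p l2 = 0) (f3 : eval p l3 = 0) :
    (Mins X1 X2 X3 l1 l2 l3).IsPrime := by
  obtain ⟨φ, H⟩ := exists_coord _ hp
  obtain ⟨σ, hσ, E1⟩ := H.lin G.x1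
  obtain ⟨Y2, hY2, E2⟩ := H.lin G.x2
  obtain ⟨Y3, hY3, E3⟩ := H.lin G.x3
  obtain ⟨m1, hm1, F1⟩ := H.lin G.y1
  obtain ⟨m2, hm2, F2⟩ := H.lin G.y2
  obtain ⟨m3, hm3, F3⟩ := H.lin G.y3
  simp only [e1, e2, e3, f1, f2, f3, map_zero, map_one, zero_mul, zero_add, one_mul]
    at E1 E2 E3 F1 F2 F3
  have hmap : (Mins X1 X2 X3 l1 l2 l3).map φ.toRingEquiv.toRingHom =
      Ideal.span {Polynomial.C (Y2 * m3 - Y3 * m2),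
      Polynomial.C m2 * Polynomial.X + Polynomial.C (σ * m2 - m1 * Y2),
      Polynomial.C m3 * Polynomial.X + Polynomial.C (σ * m3 - m1 * Y3)} := by
    rw [Mins, Ideal.map_span, Set.image_insert_eq, Set.image_pair]
    have a1 : φ.toRingEquiv.toRingHom (X2 * l3 - X3 * l2) = Polynomial.C (Y2 * m3 - Y3 * m2) := by
      change φ _ = _
      rw [map_sub, map_mul, map_mul, E2, E3, F2, F3, map_sub, map_mul, map_mul]
    have a2 : φ.toRingEquiv.toRingHom (X1 * l2 - X2 * l1) =
        Polynomial.C m2 * Polynomial.X + Polynomial.C (σ * m2 - m1 * Y2) := by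
      change φ _ = _
      rw [map_sub, map_mul, map_mul, E2, E1, F2, F1, map_sub, map_mul, map_mul]
      ring
    have a3 : φ.toRingEquiv.toRingHom (X1 * l3 - X3 * l1) =
        Polynomial.C m3 * Polynomial.X + Polynomial.C (σ * m3 - m1 * Y3) := by
      change φ _ = _
      rw [map_sub, map_mul, map_mul, E3, E1, F3, F1, map_sub, map_mul, map_mul]
      ring
    rw [a1, a2, a3]
  have hpr : ((Mins X1 X2 X3 l1 l2 l3).map φ.toRingEquiv.toRingHom).IsPrime := by
    rw [hmap]
    refine detCore hY2 hY3 hm1 hm2 hm3 ?_ ?_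
    · intro a b c h
      by_contra hn
      refine G.gen a b c (by tauto) 0 1 (Or.inr one_ne_zero) (φ.injective ?_)
      simp only [map_add, map_mul, coord_C, F1, F2, F3, map_zero, map_one, zero_mul, zero_add,
        one_mul]
      rw [← map_mul, ← map_mul, ← map_mul, ← map_add, ← map_add, h, map_zero]
    · intro b c u v hbc huv h
      refine G.gen 0 b c (by tauto) u v huv (φ.injective ?_)
      simp only [map_add, map_mul, coord_C, E2, E3, F2, F3, map_zero, zero_mul, zero_add]
      simp only [← map_mul, ← map_add]
      rw [h, map_zero]
  rw [← Ideal.comap_map_of_bijective φ.toRingEquiv.toRingHom φ.bijective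
    (I := Mins X1 X2 X3 l1 l2 l3)]
  exact Ideal.comap_isPrime _ _

lemma detPrime1 [IsAlgClosed k] {n : ℕ} {X1 X2 X3 l1 l2 l3 : MvPolynomial (Fin (n + 1)) k}
    (G : Gen3 X1 X2 X3 l1 l2 l3) {p : Fin (n + 1) → k} (hp : p ≠ 0)
    (e1 : eval p X1 ≠ 0)
    (f1 : eval p l1 = 0) (f2 : eval p l2 = 0) (f3 : eval p l3 = 0) :
    (Mins X1 X2 X3 l1 l2 l3).IsPrime := by
  obtain ⟨t, ht⟩ : ∃ t, t * eval p X1 = 1 := ⟨_, inv_mul_cancel₀ e1⟩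
  have ht0 : t ≠ 0 := by rintro rfl; simp at ht
  have hC : C t * C (eval p X1) = (1 : MvPolynomial (Fin (n + 1)) k) := by rw [← C_mul, ht, C_1]
  set r := eval p X2
  set s := eval p X3
  have G' : Gen3 (C t * X1) (X2 - C r * (C t * X1)) (X3 - C s * (C t * X1))
      (C t * l1) (l2 - C r * (C t * l1)) (l3 - C s * (C t * l1)) := by
    refine ⟨G.x1.C_mul _, G.x2.sub ((G.x1.C_mul _).C_mul _), G.x3.sub ((G.x1.C_mul _).C_mul _),
      G.y1.C_mul _, G.y2.sub ((G.y1.C_mul _).C_mul _), G.y3.sub ((G.y1.C_mul _).C_mul _), ?_⟩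
    intro a b c habc u v huv h
    refine G.gen (t * (a - b * r - c * s)) b c ?_ u v huv ?_
    · by_contra hn
      push Not at hn
      obtain ⟨h1, h2, h3⟩ := hn
      rw [h2, h3] at h1 habc
      simp [ht0] at h1 habc
      exact habc h1
    · rw [← h]
      simp only [map_sub, map_mul]
      ring
  have := detPrime0 G' hp (by simp [ht]) (by simp [ht, r]) (by simp [ht, s])
    (by simp [f1]) (by simp [f1, f2]) (by simp [f1, f3])
  convert this using 1
  unfold Mins
  apply le_antisymm
  · refine span_triple_le (a := 1) (b := C s * (-1)) (c := C r) (d := 0) (e := C (eval p X1))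
      (i := 0) (j := 0) (l := 0) (m := C (eval p X1)) ?_ ?_ ?_
    · ring
    · linear_combination (-(X1 * l2 - X2 * l1)) * hC
    · linear_combination (-(X1 * l3 - X3 * l1)) * hC
  · refine span_triple_le (a := 1) (b := C s * C t) (c := -C r * C t) (d := 0) (e := C t)
      (i := 0) (j := 0) (l := 0) (m := C t) ?_ ?_ ?_ <;> ring

lemma Gen3.rot {N : ℕ} {X1 X2 X3 l1 l2 l3 : MvPolynomial (Fin N) k}
    (G : Gen3 X1 X2 X3 l1 l2 l3) : Gen3 X2 X3 X1 l2 l3 l1 :=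
  ⟨G.x2, G.x3, G.x1, G.y2, G.y3, G.y1, fun a b c h u v huv e => G.gen c a b (by tauto) u v huv
    (by rw [← e]; ring)⟩

lemma Mins.rot {N : ℕ} (X1 X2 X3 l1 l2 l3 : MvPolynomial (Fin N) k) :
    Mins X2 X3 X1 l2 l3 l1 = Mins X1 X2 X3 l1 l2 l3 := by
  unfold Mins
  apply le_antisymm
  · refine span_triple_le (a := 0) (b := 0) (c := -1) (d := 1) (e := 0)
      (i := 0) (j := 0) (l := -1) (m := 0) ?_ ?_ ?_ <;> ring
  · refine span_triple_le (a := 0) (b := 1) (c := 0) (d := 0) (e := 0)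
      (i := -1) (j := -1) (l := 0) (m := 0) ?_ ?_ ?_ <;> ring

lemma lin_ext {N : ℕ} {f : MvPolynomial (Fin N) k} (hf : f.IsHomogeneous 1)
    (h : ∀ i, coeff (Finsupp.single i 1) f = 0) : f = 0 := by
  obtain ⟨a, rfl⟩ := linear_form hf
  apply Finset.sum_eq_zero
  intro i _
  have := h i
  rw [coeff_sum, Finset.sum_eq_single i] at this
  · rw [coeff_C_mul, coeff_X, if_pos rfl, mul_one] at this
    rw [this, C_0, zero_mul]
  · intro j _ hj
    rw [coeff_C_mul, coeff_X, if_neg, mul_zero]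
    intro e
    exact hj (Finsupp.single_left_injective one_ne_zero e)
  · intro hi
    exact absurd (Finset.mem_univ i) hi

lemma Gen3.card [IsAlgClosed k] {N : ℕ} {X1 X2 X3 l1 l2 l3 : MvPolynomial (Fin N) k}
    (G : Gen3 X1 X2 X3 l1 l2 l3) : 3 < N := by
  by_contra hN
  push Not at hN
  let A : (Fin 3 → k) →ₗ[k] (Fin N → k) := Matrix.toLin' (Matrix.of fun i j =>
    coeff (Finsupp.single i 1) (![X1, X2, X3] j))
  let B : (Fin 3 → k) →ₗ[k] (Fin N → k) := Matrix.toLin' (Matrix.of fun i j =>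
    coeff (Finsupp.single i 1) (![l1, l2, l3] j))
  have key : ∀ (v : Fin 3 → k) (t u : k), v ≠ 0 → (t ≠ 0 ∨ u ≠ 0) → t • A v + u • B v = 0 →
      False := by
    intro v t u hv htu h
    refine G.gen (v 0) (v 1) (v 2) ?_ t u htu ?_
    · by_contra hn
      push Not at hn
      apply hv
      ext i
      fin_cases i
      · exact hn.1
      · exact hn.2.1
      · exact hn.2.2
    · apply lin_ext
      · exact ((((G.x1.C_mul _).add (G.x2.C_mul _)).add (G.x3.C_mul _)).C_mul _).add
          ((((G.y1.C_mul _).add (G.y2.C_mul _)).add (G.y3.C_mul _)).C_mul _)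
      · intro i
        have := congrFun h i
        simp [A, B, Matrix.mulVec, dotProduct, Fin.sum_univ_three] at this
        simp only [coeff_add, coeff_C_mul]
        rw [← this]
        ring
  have hinj : Function.Injective A := by
    rw [← LinearMap.ker_eq_bot, LinearMap.ker_eq_bot']
    intro v hv
    by_contra hn
    exact key v 1 0 hn (Or.inl one_ne_zero) (by rw [hv]; simp)
  have h3 : 3 ≤ N := by
    have := LinearMap.finrank_le_finrank_of_injective hinj
    simpa using this
  obtain rfl : N = 3 := by omega
  let E := LinearEquiv.ofInjectiveEndo A hinj
  let T : Module.End k (Fin 3 → k) := E.symm.toLinearMap ∘ₗ B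
  obtain ⟨t, ht⟩ := Module.End.exists_eigenvalue T
  obtain ⟨v, hv⟩ := ht.exists_hasEigenvector
  refine key v t (-1) hv.2 (Or.inr (by simp)) ?_
  have h1 : T v = t • v := hv.apply_eq_smul
  have h2 : B v = A (T v) := by
    change B v = E (E.symm (B v))
    rw [LinearEquiv.apply_symm_apply]
  rw [h2, h1, map_smul]
  simp

theorem detPrime [IsAlgClosed k] : ∀ (N : ℕ) (X1 X2 X3 l1 l2 l3 : MvPolynomial (Fin N) k),
    Gen3 X1 X2 X3 l1 l2 l3 → (Mins X1 X2 X3 l1 l2 l3).IsPrime := by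
  classical
  intro N
  induction N with
  | zero =>
    intro X1 X2 X3 l1 l2 l3 G
    exact absurd G.card (by norm_num)
  | succ n IH =>
  intro X1 X2 X3 l1 l2 l3 G
  have hN := G.card
  obtain ⟨p, hp, hp2⟩ := exists_zero (k := k) (N := n + 1) {l1, l2, l3}
    (lt_of_le_of_lt Finset.card_le_three hN) (by
      intro f hf
      simp only [Finset.mem_insert, Finset.mem_singleton] at hf
      rcases hf with rfl | rfl | rfl
      · exact eval_zero_homog G.y1 (by norm_num)
      · exact eval_zero_homog G.y2 (by norm_num)
      · exact eval_zero_homog G.y3 (by norm_num))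
  have f1 := hp2 l1 (by simp)
  have f2 := hp2 l2 (by simp)
  have f3 := hp2 l3 (by simp)
  by_cases e1 : eval p X1 = 0
  · by_cases e2 : eval p X2 = 0
    · by_cases e3 : eval p X3 = 0
      · obtain ⟨φ, H⟩ := exists_coord _ hp
        obtain ⟨Y1, hY1, E1⟩ := H.lin G.x1
        obtain ⟨Y2, hY2, E2⟩ := H.lin G.x2
        obtain ⟨Y3, hY3, E3⟩ := H.lin G.x3
        obtain ⟨m1, hm1, F1⟩ := H.lin G.y1
        obtain ⟨m2, hm2, F2⟩ := H.lin G.y2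
        obtain ⟨m3, hm3, F3⟩ := H.lin G.y3
        simp only [e1, e2, e3, f1, f2, f3, map_zero, zero_mul, zero_add]
          at E1 E2 E3 F1 F2 F3
        have G' : Gen3 Y1 Y2 Y3 m1 m2 m3 := by
          refine ⟨hY1, hY2, hY3, hm1, hm2, hm3, fun a b c habc u v huv h => ?_⟩
          refine G.gen a b c habc u v huv (φ.injective ?_)
          simp only [map_add, map_mul, coord_C, E1, E2, E3, F1, F2, F3]
          simp only [← map_mul, ← map_add]
          rw [h, map_zero, map_zero]
        have hpr0 := IH _ _ _ _ _ _ G'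
        have hpr1 := Ideal.isPrime_map_C_of_isPrime (P := Mins Y1 Y2 Y3 m1 m2 m3)
        have hmap : (Mins X1 X2 X3 l1 l2 l3).map φ.toRingEquiv.toRingHom =
            (Mins Y1 Y2 Y3 m1 m2 m3).map Polynomial.C := by
          rw [Mins, Mins, Ideal.map_span, Set.image_insert_eq, Set.image_pair,
            Ideal.map_span, Set.image_insert_eq, Set.image_pair]
          have a0 : ∀ {x y z w : MvPolynomial (Fin (n + 1)) k} {x' y' z' w'},
              φ x = Polynomial.C x' → φ y = Polynomial.C y' →
              φ z = Polynomial.C z' → φ w = Polynomial.C w' →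
              φ.toRingEquiv.toRingHom (x * y - z * w) = Polynomial.C (x' * y' - z' * w') := by
            intro x y z w x' y' z' w' h1 h2 h3 h4
            change φ _ = _
            rw [map_sub, map_mul, map_mul, h1, h2, h3, h4, map_sub, map_mul, map_mul]
          rw [a0 E2 F3 E3 F2, a0 E1 F2 E2 F1, a0 E1 F3 E3 F1]
        rw [← hmap] at hpr1
        rw [← Ideal.comap_map_of_bijective φ.toRingEquiv.toRingHom φ.bijective
          (I := Mins X1 X2 X3 l1 l2 l3)]
        exact Ideal.comap_isPrime _ _
      · rw [← Mins.rot, ← Mins.rot]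
        exact detPrime1 G.rot.rot hp e3 f3 f1 f2
    · rw [← Mins.rot]
      exact detPrime1 G.rot hp e2 f2 f3 f1
  · exact detPrime1 G hp e1 f1 f2 f3

end DetPrime2

section Final
variable {k : Type} [Field k] {N : ℕ}

local notation "RR" => MvPolynomial (Fin N) k

lemma span3_eq {A : Type*} [CommRing A] (x y z : A) :
    Ideal.span {x, y, z} = Ideal.span {x, y} ⊔ Ideal.span {z} := by
  rw [← Ideal.span_union]
  congr 1
  ext u
  simp
  tauto

lemma PD.prime_pair {q1 q2 : RR} (h : (Ideal.span {q1, q2}).IsPrime) (c : RR) :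
    PD (Ideal.span {q1, q2, c}) 4 := by
  by_cases hc : c ∈ Ideal.span {q1, q2}
  · rw [span3_eq, sup_eq_left.2 ((Ideal.span_singleton_le_iff_mem _).2 hc)]
    exact (PD.pair q1 q2).mono (by norm_num)
  · have : PD (Ideal.span {q1, q2, c}) 3 := by
      refine PD.sup (J := Ideal.span {q1, q2}) (J' := Ideal.span {q1, q2}) (c := c) (n := 2) ?_
        (span3_eq _ _ _) (PD.pair q1 q2) ((PD.pair q1 q2).mono (by norm_num))
      intro u
      exact ⟨fun h => Ideal.mul_mem_right _ _ h, fun hu => (h.mem_or_mem hu).resolve_right hc⟩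
    exact this.mono (by norm_num)

/-- the abstract liaison argument -/
lemma PD.link {q1 q2 D x y c : RR} {L : Ideal RR} (hL : L = Ideal.span {q1, q2, D})
    (hLp : L.IsPrime) (hP : (Ideal.span {x, y}).IsPrime)
    (h1 : q1 ∈ Ideal.span {x, y}) (h2 : q2 ∈ Ideal.span {x, y}) (hD : D ∉ Ideal.span {x, y})
    (hx : x * D ∈ Ideal.span {q1, q2}) (hy : y * D ∈ Ideal.span {q1, q2}) :
    PD (Ideal.span {q1, q2, c}) 4 := by
  set I := Ideal.span {q1, q2} with hI
  set P := Ideal.span {x, y} with hPd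
  have hIP : I ≤ P := by
    rw [hI, Ideal.span_le]
    rintro u (rfl | rfl)
    · exact h1
    · exact h2
  have hL' : L = I ⊔ Ideal.span {D} := by rw [hL, span3_eq]
  have hIL : I ≤ L := by rw [hL']; exact le_sup_left
  have hDL : D ∈ L := by rw [hL']; exact Ideal.mem_sup_right (Ideal.mem_span_singleton_self D)
  have hPD : ∀ u ∈ P, u * D ∈ I := by
    intro u hu
    obtain ⟨a, b, rfl⟩ := Ideal.mem_span_pair.1 hu
    rw [add_mul, mul_assoc, mul_assoc]
    exact Ideal.add_mem _ (Ideal.mul_mem_left _ _ hx) (Ideal.mul_mem_left _ _ hy)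
  have hPL : ∀ u, u ∈ P → u ∈ L → u ∈ I := by
    intro u hu hu2
    rw [hL'] at hu2
    obtain ⟨i, hi, j, hj, rfl⟩ := Submodule.mem_sup.1 hu2
    obtain ⟨g, rfl⟩ := Ideal.mem_span_singleton'.1 hj
    have h3 : g * D ∈ P := (Ideal.add_mem_iff_right _ (hIP hi)).1 hu
    exact Ideal.add_mem _ hi (hPD g ((hP.mem_or_mem h3).resolve_right hD))
  have p1 : PD P 2 := PD.pair x y
  have p2 : PD I 2 := PD.pair q1 q2
  have p3 : PD L 3 := by
    refine PD.sup (J := I) (J' := P) (c := D) (n := 2) ?_ hL' p1 (p2.mono (by norm_num))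
    intro u
    exact ⟨hPD u, fun h => (hP.mem_or_mem (hIP h)).resolve_right hD⟩
  by_cases c1 : c ∈ P
  · by_cases c2 : c ∈ L
    · rw [span3_eq, sup_eq_left.2 ((Ideal.span_singleton_le_iff_mem _).2 (hPL c c1 c2))]
      exact p2.mono (by norm_num)
    · refine PD.sup (J := I) (J' := L) (c := c) (n := 3) ?_ (span3_eq _ _ _) p3
        (p2.mono (by norm_num))
      intro u
      refine ⟨fun h => hPL _ (Ideal.mul_mem_left _ _ c1) (Ideal.mul_mem_right _ _ h), fun h => ?_⟩
      exact (hLp.mem_or_mem (hIL h)).resolve_right c2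
  · by_cases c2 : c ∈ L
    · refine PD.sup (J := I) (J' := P) (c := c) (n := 3) ?_ (span3_eq _ _ _) (p1.mono (by norm_num))
        (p2.mono (by norm_num))
      intro u
      refine ⟨fun h => hPL _ (Ideal.mul_mem_right _ _ h) (Ideal.mul_mem_left _ _ c2), fun h => ?_⟩
      exact (hP.mem_or_mem (hIP h)).resolve_right c1
    · refine PD.sup (J := I) (J' := I) (c := c) (n := 3) ?_ (span3_eq _ _ _) (p2.mono (by norm_num))
        (p2.mono (by norm_num))
      intro u
      refine ⟨fun h => Ideal.mul_mem_right _ _ h, fun h => ?_⟩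
      exact hPL _ ((hP.mem_or_mem (hIP h)).resolve_right c1)
        ((hLp.mem_or_mem (hIL h)).resolve_right c2)

lemma coeff_mul_low {q f : RR} (hq : q.IsHomogeneous 2) (i : Fin N) :
    coeff (Finsupp.single i 1) (f * q) = 0 := by
  classical
  rw [coeff_mul]
  apply Finset.sum_eq_zero
  rintro ⟨u, v⟩ huv
  rw [Finset.HasAntidiagonal.mem_antidiagonal] at huv
  have : coeff v q = 0 := by
    apply hq.coeff_eq_zero
    have h1 := congrArg Finsupp.degree huv
    simp only [map_add, Finsupp.degree_single] at h1
    omega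
  rw [this, mul_zero]

lemma PD.linear_case [IsAlgClosed k] {q1 q2 x y c : RR} (hq1 : q1.IsHomogeneous 2)
    (hq2 : q2.IsHomogeneous 2) (hA : AllIrr q1 q2) (hx : x.IsHomogeneous 1)
    (hy : y.IsHomogeneous 1) (h1 : q1 ∈ Ideal.span {x, y}) (h2 : q2 ∈ Ideal.span {x, y}) :
    PD (Ideal.span {q1, q2, c}) 4 := by
  have i1 : Irreducible q1 := by simpa using hA 1 0 (Or.inl one_ne_zero)
  obtain ⟨a, b, ha, hb, e1⟩ := homog_mem_pair (e := 1) hx hy hq1 h1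
  obtain ⟨a', b', ha', hb', e2⟩ := homog_mem_pair (e := 1) hx hy hq2 h2
  have hCu : ∀ u : k, u ≠ 0 → ∀ f g : RR, f ∣ C u * g → f ∣ g := by
    intro u hu f g h
    have : g = C u⁻¹ * (C u * g) := by
      rw [← mul_assoc, ← C_mul, inv_mul_cancel₀ hu, C_1, one_mul]
    rw [this]
    exact h.mul_left _
  have hind : Ind x y := by
    intro u v huv
    by_contra hn
    by_cases hu : u = 0
    · have hv : v ≠ 0 := by tauto
      rw [hu] at huv
      simp [hv] at huv
      exact irr_no_lin hq1 i1 hx ⟨a, by rw [e1, huv]; ring⟩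
    · refine irr_no_lin hq1 i1 hy (hCu u hu _ _ ⟨C u * b - C v * a, ?_⟩)
      rw [e1]
      linear_combination a * huv
  have hP := hind.prime hx hy
  have G : Gen3 a a' y b b' (-x) := by
    refine ⟨ha, ha', hy, hb, hb', hx.neg, ?_⟩
    intro α β γ hαβ u v huv e
    by_cases hz : α ≠ 0 ∨ β ≠ 0
    · have hl : (C v * x - C u * y).IsHomogeneous 1 := (hx.C_mul v).sub (hy.C_mul u)
      refine irr_no_lin (pencil_homog hq1 hq2 α β) (hA α β hz) hl ?_
      by_cases hu : u = 0
      · have hv : v ≠ 0 := by tauto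
        refine hCu v hv _ _ ⟨C α * a + C β * a' + C γ * y, ?_⟩
        rw [e1, e2]
        linear_combination y * e
      · refine hCu u hu _ _ ⟨C γ * x - (C α * b + C β * b'), ?_⟩
        rw [e1, e2]
        linear_combination x * e
    · push Not at hz
      obtain ⟨rfl, rfl⟩ := hz
      have hγ : γ ≠ 0 := by tauto
      have := hind (-(v * γ)) (u * γ) (by
        rw [← e]; simp only [map_neg, map_mul, map_zero]; ring)
      simp [hγ] at this
      tauto
  have hL : Mins a a' y b b' (-x) = Ideal.span {q1, q2, a * b' - a' * b} := by
    unfold Mins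
    apply le_antisymm
    · refine span_triple_le (a := 0) (b := -1) (c := 0) (d := 0) (e := 0) (i := 1) (j := -1)
        (l := 0) (m := 0) ?_ ?_ ?_
      · rw [e2]; ring
      · ring
      · rw [e1]; ring
    · refine span_triple_le (a := 0) (b := 0) (c := -1) (d := -1) (e := 0) (i := 0) (j := 0)
        (l := 1) (m := 0) ?_ ?_ ?_
      · rw [e1]; ring
      · rw [e2]; ring
      · ring
  have hLp := detPrime _ _ _ _ _ _ _ G
  refine PD.link hL hLp hP h1 h2 ?_ ?_ ?_
  · intro hD
    have hLP : Mins a a' y b b' (-x) < Ideal.span {x, y} := by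
      refine lt_of_le_of_ne ?_ ?_
      · rw [hL, Ideal.span_le]
        rintro u (rfl | rfl | rfl)
        · exact h1
        · exact h2
        · exact hD
      · intro e
        have hx' : x ∈ Mins a a' y b b' (-x) := by
          rw [e]
          exact Ideal.subset_span (by simp)
        rw [hL] at hx'
        obtain ⟨f, g, h, hfgh⟩ := mem_span_triple.1 hx'
        apply hind.left
        apply lin_ext hx
        intro i
        rw [← hfgh, coeff_add, coeff_add, coeff_mul_low hq1, coeff_mul_low hq2,
          coeff_mul_low ((ha.mul hb').sub (ha'.mul hb))]
        simp
    have hq1p : (Ideal.span {q1}).IsPrime :=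
      (Ideal.span_singleton_prime i1.ne_zero).2 i1.prime
    have hqL : Ideal.span {q1} < Mins a a' y b b' (-x) := by
      refine lt_of_le_of_ne ?_ ?_
      · rw [hL, Ideal.span_singleton_le_iff_mem]
        exact Ideal.subset_span (by simp)
      · intro e
        have : q2 ∈ Ideal.span {q1} := by
          rw [e, hL]
          exact Ideal.subset_span (by simp)
        obtain ⟨t, ht⟩ := homog_dvd hq1 hq2 (Ideal.mem_span_singleton.1 this)
        have := (hA (-t) 1 (Or.inr one_ne_zero)).ne_zero
        apply this
        rw [ht]
        simp
    have h0q : (⊥ : Ideal RR) < Ideal.span {q1} := by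
      rw [bot_lt_iff_ne_bot, Ne, Ideal.span_singleton_eq_bot]
      exact i1.ne_zero
    have hb0 : (⊥ : Ideal RR).IsPrime := Ideal.isPrime_bot
    have k1 := Ideal.height_strict_mono_of_isPrime_of_isPrime h0q
    have k2 := Ideal.height_strict_mono_of_isPrime_of_isPrime hqL
    have k3 := Ideal.height_strict_mono_of_isPrime_of_isPrime hLP
    classical
    have k4 := Ideal.height_le_card_of_mem_minimalPrimes_span_finset (p := Ideal.span {x, y})
      (s := {x, y}) (by
        rw [Finset.coe_pair, Ideal.minimalPrimes_eq_subsingleton_self]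
        rfl)
    have k5 : (Ideal.span {x, y}).height ≤ (2 : ℕ) :=
      k4.trans (by exact_mod_cast Finset.card_le_two)
    have c1 := Order.add_one_le_of_lt k1
    have c2 := Order.add_one_le_of_lt k2
    have c3 := Order.add_one_le_of_lt k3
    have : ((3 : ℕ) : ℕ∞) ≤ (2 : ℕ) := by
      calc ((3 : ℕ) : ℕ∞) = 0 + 1 + 1 + 1 := by norm_num
        _ ≤ (⊥ : Ideal RR).height + 1 + 1 + 1 := by gcongr; exact zero_le
        _ ≤ (Ideal.span {q1}).height + 1 + 1 := by gcongr
        _ ≤ (Mins a a' y b b' (-x)).height + 1 := by gcongr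
        _ ≤ _ := c3
        _ ≤ _ := k5
    exact absurd (by exact_mod_cast this : 3 ≤ 2) (by norm_num)
  · exact Ideal.mem_span_pair.2 ⟨b', -b, by rw [e1, e2]; ring⟩
  · exact Ideal.mem_span_pair.2 ⟨-a', a, by rw [e1, e2]; ring⟩

theorem PD.main [IsAlgClosed k] {q1 q2 c : RR} (hq1 : q1.IsHomogeneous 2)
    (hq2 : q2.IsHomogeneous 2) : PD (Ideal.span {q1, q2, c}) 4 := by
  by_cases hA : AllIrr q1 q2
  · rcases claimA _ _ _ hq1 hq2 hA with h | ⟨x, y, hx, hy, h1, h2⟩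
    · exact PD.prime_pair h c
    · exact PD.linear_case hq1 hq2 hA hx hy h1 h2
  · exact PD.reduce hq1 hq2 hA

end Final

theorem statement_5 {k : Type} [Field k] [IsAlgClosed k] {N : ℕ}
    (q₁ q₂ c : MvPolynomial (Fin N) k)
    (hq₁ : q₁.IsHomogeneous 2) (hq₂ : q₂.IsHomogeneous 2) (hc : c.IsHomogeneous 3) :
    pdQuotLE (Ideal.span {q₁, q₂, c}) 4 := by
  exact exists_res 4 _ (PD.main hq₁ hq₂)

end
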